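/- arXiv:0706.0662 — 4 statements merged into one kernel-verified Lean document; each statement's English description precedes it below -/
import Mathlib

section
/- Let n ≥ 1 and let A be the Rees ring of the n-th Weyl algebra over ℂ. For every non-trivial finite group G of ℂ-algebra automorphisms of A, each of which maps the degree-one subspace V of A onto itself, the fixed subalgebra A^G = {a ∈ A : g(a) = a for all g ∈ G} is not isomorphic to A as a ℂ-algebra. -/
/-- Index type for the generators of the Rees ring of the `n`-th Weyl algebra:
`some (i, false)` is `xᵢ`, `some (i, true)` is `yᵢ`, and `none` is `z`. -/
abbrev ReesGen (n : ℕ) : Type := Option (Fin n × Bool)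

/-- The defining relations of the Rees ring of the `n`-th Weyl algebra:
`xᵢ yᵢ = yᵢ xᵢ + z²`, and all other pairs of generators commute. -/
inductive ReesRel (n : ℕ) : FreeAlgebra ℂ (ReesGen n) → FreeAlgebra ℂ (ReesGen n) → Prop
  | weyl (i : Fin n) :
      ReesRel n (FreeAlgebra.ι ℂ (some (i, false)) * FreeAlgebra.ι ℂ (some (i, true)))
        (FreeAlgebra.ι ℂ (some (i, true)) * FreeAlgebra.ι ℂ (some (i, false)) +
          FreeAlgebra.ι ℂ (none : ReesGen n) * FreeAlgebra.ι ℂ (none : ReesGen n))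
  | comm (a b : ReesGen n)
      (h : ∀ i : Fin n, ¬(a = some (i, false) ∧ b = some (i, true)))
      (h' : ∀ i : Fin n, ¬(a = some (i, true) ∧ b = some (i, false))) :
      ReesRel n (FreeAlgebra.ι ℂ a * FreeAlgebra.ι ℂ b)
        (FreeAlgebra.ι ℂ b * FreeAlgebra.ι ℂ a)

/-- The Rees ring of the `n`-th Weyl algebra. -/
abbrev ReesWeyl (n : ℕ) : Type := RingQuot (ReesRel n)

/-- The generator `xᵢ` of the Rees ring of the `n`-th Weyl algebra. -/
noncomputable def reesX (n : ℕ) (i : Fin n) : ReesWeyl n :=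
  RingQuot.mkAlgHom ℂ (ReesRel n) (FreeAlgebra.ι ℂ (some (i, false)))

/-- The generator `yᵢ` of the Rees ring of the `n`-th Weyl algebra. -/
noncomputable def reesY (n : ℕ) (i : Fin n) : ReesWeyl n :=
  RingQuot.mkAlgHom ℂ (ReesRel n) (FreeAlgebra.ι ℂ (some (i, true)))

/-- The central generator `z` of the Rees ring of the `n`-th Weyl algebra. -/
noncomputable def reesZ (n : ℕ) : ReesWeyl n :=
  RingQuot.mkAlgHom ℂ (ReesRel n) (FreeAlgebra.ι ℂ (none : ReesGen n))

/-- The degree-one subspace `V` of the Rees ring: the span of the images of the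
`2n+1` generators. -/
noncomputable def reesV (n : ℕ) : Submodule ℂ (ReesWeyl n) :=
  Submodule.span ℂ (Set.range fun g : ReesGen n =>
    RingQuot.mkAlgHom ℂ (ReesRel n) (FreeAlgebra.ι ℂ g))

/-- The fixed subalgebra `A^G` of a group `G` of algebra automorphisms of `A`. -/
def fixedSubalgebra {A : Type*} [Semiring A] [Algebra ℂ A]
    (G : Subgroup (A ≃ₐ[ℂ] A)) : Subalgebra ℂ A where
  carrier := {a | ∀ g ∈ G, g a = a}
  mul_mem' := by
    intro a b ha hb g hg
    show g (a * b) = a * b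
    rw [map_mul, ha g hg, hb g hg]
  add_mem' := by
    intro a b ha hb g hg
    show g (a + b) = a + b
    rw [map_add, ha g hg, hb g hg]
  algebraMap_mem' := fun r g _ => g.commutes r


/-! ### Generators, lifting and induction -/

noncomputable def rGen (n : ℕ) (g : ReesGen n) : ReesWeyl n :=
  RingQuot.mkAlgHom ℂ (ReesRel n) (FreeAlgebra.ι ℂ g)

theorem rees_induction {n : ℕ} {P : ReesWeyl n → Prop}
    (h0 : ∀ r : ℂ, P (algebraMap ℂ _ r)) (h1 : ∀ g, P (rGen n g))
    (hm : ∀ a b, P a → P b → P (a * b)) (ha : ∀ a b, P a → P b → P (a + b)) (a) : P a := by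
  obtain ⟨a, rfl⟩ := RingQuot.mkAlgHom_surjective ℂ (ReesRel n) a
  induction a using FreeAlgebra.induction with
  | grade0 r => rw [AlgHom.commutes]; exact h0 r
  | grade1 x => exact h1 x
  | mul a b iha ihb => rw [map_mul]; exact hm _ _ iha ihb
  | add a b iha ihb => rw [map_add]; exact ha _ _ iha ihb

theorem rees_weyl {n : ℕ} (i : Fin n) :
    rGen n (some (i, false)) * rGen n (some (i, true)) =
      rGen n (some (i, true)) * rGen n (some (i, false)) + rGen n none * rGen n none := by
  have := RingQuot.mkAlgHom_rel ℂ (ReesRel.weyl i)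
  simp only [map_mul, map_add] at this
  exact this

theorem rees_comm {n : ℕ} (a b : ReesGen n)
      (h : ∀ i : Fin n, ¬(a = some (i, false) ∧ b = some (i, true)))
      (h' : ∀ i : Fin n, ¬(a = some (i, true) ∧ b = some (i, false))) :
    rGen n a * rGen n b = rGen n b * rGen n a := by
  have := RingQuot.mkAlgHom_rel ℂ (ReesRel.comm a b h h')
  simp only [map_mul] at this
  exact this

theorem rees_lift_exists {n : ℕ} {B : Type*} [Semiring B] [Algebra ℂ B] (f : ReesGen n → B)
    (hw : ∀ i : Fin n, f (some (i, false)) * f (some (i, true)) =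
      f (some (i, true)) * f (some (i, false)) + f none * f none)
    (hc : ∀ a b : ReesGen n, (∀ i : Fin n, ¬(a = some (i, false) ∧ b = some (i, true))) →
      (∀ i : Fin n, ¬(a = some (i, true) ∧ b = some (i, false))) → f a * f b = f b * f a) :
    ∃ F : ReesWeyl n →ₐ[ℂ] B, ∀ g, F (rGen n g) = f g := by
  refine ⟨RingQuot.liftAlgHom ℂ ⟨FreeAlgebra.lift ℂ f, ?_⟩, ?_⟩
  · intro x y h
    cases h with
    | weyl i => simp only [map_mul, map_add, FreeAlgebra.lift_ι_apply]; exact hw i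
    | comm a b h h' => simp only [map_mul, FreeAlgebra.lift_ι_apply]; exact hc a b h h'
  · intro g
    rw [rGen, RingQuot.liftAlgHom_mkAlgHom_apply, FreeAlgebra.lift_ι_apply]

theorem rees_z_central {n : ℕ} (a : ReesWeyl n) : rGen n none * a = a * rGen n none := by
  induction a using rees_induction with
  | h0 r => exact (Algebra.commutes r _).symm
  | h1 g => exact rees_comm _ _ (by simp) (by simp)
  | hm a b ha hb => rw [← mul_assoc, ha, mul_assoc, hb, mul_assoc]
  | ha a b ha hb => rw [mul_add, add_mul, ha, hb]

/-! ### The degree map -/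

theorem rees_deg_exists (n : ℕ) : ∃ F : ReesWeyl n →ₐ[ℂ] Polynomial (ReesWeyl n),
    ∀ g, F (rGen n g) = Polynomial.C (rGen n g) * Polynomial.X := by
  have key : ∀ u v : ReesWeyl n, (Polynomial.C u * Polynomial.X) * (Polynomial.C v * Polynomial.X)
      = Polynomial.C (u * v) * Polynomial.X ^ 2 := by
    intro u v
    rw [mul_assoc, ← mul_assoc Polynomial.X, Polynomial.X_mul_C, Polynomial.C_mul, pow_two]
    simp only [mul_assoc]
  apply rees_lift_exists
  · intro i
    simp only [key, ← add_mul, ← Polynomial.C_add, rees_weyl]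
  · intro a b h h'
    simp only [key, rees_comm a b h h']

noncomputable def degHom (n : ℕ) : ReesWeyl n →ₐ[ℂ] Polynomial (ReesWeyl n) :=
  (rees_deg_exists n).choose

theorem degHom_gen {n : ℕ} (g) :
    degHom n (rGen n g) = Polynomial.C (rGen n g) * Polynomial.X := (rees_deg_exists n).choose_spec g

noncomputable def cf {n : ℕ} (k : ℕ) (a : ReesWeyl n) : ReesWeyl n := (degHom n a).coeff k

theorem cf_add {n k : ℕ} (a b : ReesWeyl n) : cf k (a + b) = cf k a + cf k b := by simp [cf]
theorem cf_sub {n k : ℕ} (a b : ReesWeyl n) : cf k (a - b) = cf k a - cf k b := by simp [cf]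
theorem cf_smul {n k : ℕ} (r : ℂ) (a : ReesWeyl n) : cf k (r • a) = r • cf k a := by simp [cf]
theorem cf_mul_zero {n : ℕ} (a b : ReesWeyl n) : cf 0 (a * b) = cf 0 a * cf 0 b := by
  simp [cf]
theorem cf_mul_one {n : ℕ} (a b : ReesWeyl n) :
    cf 1 (a * b) = cf 0 a * cf 1 b + cf 1 a * cf 0 b := by
  simp [cf, Polynomial.mul_coeff_one]
theorem cf_mul_two {n : ℕ} (a b : ReesWeyl n) :
    cf 2 (a * b) = cf 0 a * cf 2 b + cf 1 a * cf 1 b + cf 2 a * cf 0 b := by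
  simp only [cf, map_mul, Polynomial.coeff_mul]
  rw [show (Finset.HasAntidiagonal.antidiagonal 2 : Finset (ℕ × ℕ)) = {(0,2),(1,1),(2,0)} from rfl]
  simp [add_assoc]

theorem cf_algebraMap {n k : ℕ} (r : ℂ) : cf k (algebraMap ℂ (ReesWeyl n) r)
    = if k = 0 then algebraMap ℂ _ r else 0 := by
  simp only [cf, AlgHom.commutes, Polynomial.algebraMap_apply, Polynomial.coeff_C]

theorem cf_gen {n k : ℕ} (g) : cf k (rGen n g) = if k = 1 then rGen n g else 0 := by
  simp only [cf, degHom_gen, Polynomial.coeff_C_mul, Polynomial.coeff_X]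
  split_ifs <;> simp_all

theorem cf_zero_scalar {n : ℕ} (a : ReesWeyl n) : ∃ r : ℂ, cf 0 a = algebraMap ℂ _ r := by
  induction a using rees_induction with
  | h0 r => exact ⟨r, by simp [cf_algebraMap]⟩
  | h1 g => exact ⟨0, by simp [cf_gen]⟩
  | hm a b ha hb =>
    obtain ⟨r, hr⟩ := ha
    obtain ⟨s, hs⟩ := hb
    exact ⟨r * s, by rw [cf_mul_zero, hr, hs, map_mul]⟩
  | ha a b ha hb =>
    obtain ⟨r, hr⟩ := ha
    obtain ⟨s, hs⟩ := hb
    exact ⟨r + s, by rw [cf_add, hr, hs, map_add]⟩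

theorem gen_mem_V {n : ℕ} (g) : rGen n g ∈ reesV n := Submodule.subset_span ⟨g, rfl⟩

theorem cf_one_mem {n : ℕ} (a : ReesWeyl n) : cf 1 a ∈ reesV n := by
  induction a using rees_induction with
  | h0 r => simp [cf_algebraMap]
  | h1 g => simp [cf_gen, gen_mem_V]
  | hm a b ha hb =>
    obtain ⟨r, hr⟩ := cf_zero_scalar a
    obtain ⟨s, hs⟩ := cf_zero_scalar b
    rw [cf_mul_one, hr, hs, ← Algebra.commutes, ← Algebra.smul_def, ← Algebra.smul_def]
    exact add_mem (Submodule.smul_mem _ _ hb) (Submodule.smul_mem _ _ ha)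
  | ha a b ha hb => rw [cf_add]; exact add_mem ha hb

theorem cf_two_comm {n : ℕ} (a b : ReesWeyl n) :
    cf 2 (a * b - b * a) = cf 1 a * cf 1 b - cf 1 b * cf 1 a := by
  obtain ⟨r, hr⟩ := cf_zero_scalar a
  obtain ⟨s, hs⟩ := cf_zero_scalar b
  rw [cf_sub, cf_mul_two, cf_mul_two, hr, hs, Algebra.commutes r, Algebra.commutes s]
  abel

theorem degHom_V {n : ℕ} {v : ReesWeyl n} (hv : v ∈ reesV n) :
    degHom n v = Polynomial.C v * Polynomial.X := by
  induction hv using Submodule.span_induction with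
  | mem x h => obtain ⟨g, rfl⟩ := h; exact degHom_gen g
  | zero => simp
  | add x y _ _ hx hy => rw [map_add, hx, hy, Polynomial.C_add, add_mul]
  | smul r x _ hx => rw [map_smul, hx, ← Polynomial.smul_C, smul_mul_assoc]

theorem degHom_equiv {n : ℕ} (g : ReesWeyl n ≃ₐ[ℂ] ReesWeyl n)
    (hg : (reesV n).map g.toLinearMap = reesV n) (a : ReesWeyl n) :
    degHom n (g a) = (degHom n a).map (g : ReesWeyl n →+* ReesWeyl n) := by
  induction a using rees_induction with
  | h0 r => simp [Polynomial.algebraMap_apply]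
  | h1 x =>
    have : g (rGen n x) ∈ reesV n := by
      rw [← hg]; exact ⟨_, gen_mem_V x, rfl⟩
    rw [degHom_V this, degHom_gen]; simp
  | hm a b ha hb => rw [map_mul, map_mul, ha, hb, map_mul, Polynomial.map_mul]
  | ha a b ha hb => rw [map_add, map_add, ha, hb, map_add, Polynomial.map_add]

theorem cf_equiv {n k : ℕ} (g : ReesWeyl n ≃ₐ[ℂ] ReesWeyl n)
    (hg : (reesV n).map g.toLinearMap = reesV n) (a : ReesWeyl n) :
    cf k (g a) = g (cf k a) := by
  simp [cf, degHom_equiv g hg]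

/-! ### The commutative quotient -/

theorem rees_pi_exists (n : ℕ) : ∃ F : ReesWeyl n →ₐ[ℂ] MvPolynomial (Fin n × Bool) ℂ,
    ∀ g, F (rGen n g) = g.elim 0 MvPolynomial.X :=
  rees_lift_exists _ (by intro i; simp [mul_comm]) (fun a b _ _ => mul_comm _ _)

noncomputable def piHom (n : ℕ) : ReesWeyl n →ₐ[ℂ] MvPolynomial (Fin n × Bool) ℂ :=
  (rees_pi_exists n).choose

theorem piHom_gen {n : ℕ} (g) : piHom n (rGen n g) = g.elim 0 MvPolynomial.X :=
  (rees_pi_exists n).choose_spec g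

theorem ring_id1 {R : Type*} [Ring R] (a a' b z c c' : R) (hz : z * a = a * z)
    (h : a * b - b * a = z * z * c) (h' : a' * b - b * a' = z * z * c') :
    a * a' * b - b * (a * a') = z * z * (c * a' + a * c') := by
  have e : a * a' * b - b * (a * a') = (a * b - b * a) * a' + a * (a' * b - b * a') := by
    noncomm_ring
  have e2 : a * (z * z * c') = z * z * (a * c') := by
    rw [← mul_assoc, ← mul_assoc, ← hz, mul_assoc z a z, ← hz]; simp only [mul_assoc]
  rw [e, h, h', e2, mul_add]; simp only [mul_assoc]

theorem ring_id2 {R : Type*} [Ring R] (a a' b z c c' : R)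
    (h : a * b - b * a = z * z * c) (h' : a' * b - b * a' = z * z * c') :
    (a + a') * b - b * (a + a') = z * z * (c + c') := by
  rw [mul_add (z * z), ← h, ← h']; noncomm_ring

theorem ring_id3 {R : Type*} [Ring R] (a b z c : R) (h : a * b - b * a = z * z * c) :
    b * a - a * b = z * z * (-c) := by
  rw [mul_neg, ← h, neg_sub]

theorem rees_comm_mod {n : ℕ} (a b : ReesWeyl n) :
    ∃ c, a * b - b * a = rGen n none * rGen n none * c := by
  induction a using rees_induction with
  | h0 r => exact ⟨0, by rw [Algebra.commutes]; simp⟩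
  | hm a a' ha ha' =>
    obtain ⟨c, hc⟩ := ha
    obtain ⟨c', hc'⟩ := ha'
    exact ⟨_, ring_id1 _ _ _ _ _ _ (rees_z_central a) hc hc'⟩
  | ha a a' ha ha' =>
    obtain ⟨c, hc⟩ := ha
    obtain ⟨c', hc'⟩ := ha'
    exact ⟨_, ring_id2 _ _ _ _ _ _ hc hc'⟩
  | h1 g =>
    suffices h : ∃ c, b * rGen n g - rGen n g * b = rGen n none * rGen n none * c by
      obtain ⟨c, hc⟩ := h
      exact ⟨_, ring_id3 _ _ _ _ hc⟩
    induction b using rees_induction with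
    | h0 r => exact ⟨0, by rw [Algebra.commutes]; simp⟩
    | hm a a' ha ha' =>
      obtain ⟨c, hc⟩ := ha
      obtain ⟨c', hc'⟩ := ha'
      exact ⟨_, ring_id1 _ _ _ _ _ _ (rees_z_central a) hc hc'⟩
    | ha a a' ha ha' =>
      obtain ⟨c, hc⟩ := ha
      obtain ⟨c', hc'⟩ := ha'
      exact ⟨_, ring_id2 _ _ _ _ _ _ hc hc'⟩
    | h1 h =>
      have pos : ∀ i : Fin n, rGen n (some (i, false)) * rGen n (some (i, true)) -
          rGen n (some (i, true)) * rGen n (some (i, false)) = rGen n none * rGen n none * 1 := by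
        intro i
        rw [rees_weyl, mul_one, add_sub_cancel_left]
      by_cases h1 : ∃ i : Fin n, h = some (i, false) ∧ g = some (i, true)
      · obtain ⟨i, rfl, rfl⟩ := h1
        exact ⟨1, pos i⟩
      by_cases h2 : ∃ i : Fin n, h = some (i, true) ∧ g = some (i, false)
      · obtain ⟨i, rfl, rfl⟩ := h2
        exact ⟨_, ring_id3 _ _ _ _ (pos i)⟩
      exact ⟨0, by rw [rees_comm h g (not_exists.1 h1) (not_exists.1 h2)]; simp⟩

noncomputable def zIdeal (n : ℕ) : Ideal (ReesWeyl n) := Ideal.span {rGen n none}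

theorem mem_zIdeal {n : ℕ} {a : ReesWeyl n} : a ∈ zIdeal n ↔ ∃ c, a = rGen n none * c := by
  rw [zIdeal, Ideal.mem_span_singleton']
  constructor
  · rintro ⟨c, rfl⟩; exact ⟨c, (rees_z_central c).symm⟩
  · rintro ⟨c, rfl⟩; exact ⟨c, (rees_z_central c).symm⟩

instance (n : ℕ) : (zIdeal n).IsTwoSided := ⟨by
  intro a b ha
  obtain ⟨c, rfl⟩ := mem_zIdeal.1 ha
  exact mem_zIdeal.2 ⟨c * b, by rw [mul_assoc]⟩⟩

theorem piHom_ker {n : ℕ} {a : ReesWeyl n} (h : piHom n a = 0) : ∃ c, a = rGen n none * c := by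
  rw [← mem_zIdeal]
  letI : CommRing (ReesWeyl n ⧸ zIdeal n) :=
    { (inferInstance : Ring (ReesWeyl n ⧸ zIdeal n)) with
      mul_comm := by
        intro x y
        obtain ⟨x, rfl⟩ := Ideal.Quotient.mk_surjective x
        obtain ⟨y, rfl⟩ := Ideal.Quotient.mk_surjective y
        rw [← map_mul, ← map_mul]
        exact Ideal.Quotient.eq.2 (mem_zIdeal.2 ((rees_comm_mod x y).imp' _ fun c hc => hc.trans (mul_assoc _ _ _))) }
  letI : Algebra ℂ (ReesWeyl n ⧸ zIdeal n) :=
    ((Ideal.Quotient.mk (zIdeal n)).comp (algebraMap ℂ (ReesWeyl n))).toAlgebra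
  let θ : MvPolynomial (Fin n × Bool) ℂ →ₐ[ℂ] (ReesWeyl n ⧸ zIdeal n) :=
    MvPolynomial.aeval (fun v => Ideal.Quotient.mk (zIdeal n) (rGen n (some v)))
  have key : ∀ a, θ (piHom n a) = Ideal.Quotient.mk (zIdeal n) a := by
    intro a
    induction a using rees_induction with
    | h0 r => rw [AlgHom.commutes, AlgHom.commutes]; rfl
    | h1 g =>
      rw [piHom_gen]
      cases g with
      | none =>
        simp only [Option.elim, map_zero]
        exact (Ideal.Quotient.eq_zero_iff_mem.2 (mem_zIdeal.2 ⟨1, by simp⟩)).symm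
      | some v => simp [θ]
    | hm a b ha hb => rw [map_mul, map_mul, ha, hb]; rfl
    | ha a b ha hb => rw [map_add, map_add, ha, hb]; rfl
  have := key a
  rw [h, map_zero] at this
  exact Ideal.Quotient.eq_zero_iff_mem.1 this.symm

set_option linter.all false
set_option linter.unusedSectionVars false
set_option linter.unusedSimpArgs false

/-! ### The star product modulo `z ^ 4` -/

section Star
open MvPolynomial
variable {n : ℕ} {K : Type} [CommRing K] [Algebra ℂ K]

noncomputable def pB (f g : MvPolynomial (Fin n × Bool) K) : MvPolynomial (Fin n × Bool) K :=
  ∑ i : Fin n, pderiv (i, false) f * pderiv (i, true) g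

theorem pB_add_left (f f' g : MvPolynomial (Fin n × Bool) K) :
    pB (f + f') g = pB f g + pB f' g := by
  simp [pB, add_mul, Finset.sum_add_distrib]

theorem pB_add_right (f g g' : MvPolynomial (Fin n × Bool) K) :
    pB f (g + g') = pB f g + pB f g' := by
  simp [pB, mul_add, Finset.sum_add_distrib]

theorem pB_mul_left (f f' g : MvPolynomial (Fin n × Bool) K) :
    pB (f * f') g = f * pB f' g + pB f g * f' := by
  simp only [pB, Derivation.leibniz, Finset.mul_sum, Finset.sum_mul, ← Finset.sum_add_distrib,
    smul_eq_mul]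
  exact Finset.sum_congr rfl fun i _ => by ring

theorem pB_mul_right (f g g' : MvPolynomial (Fin n × Bool) K) :
    pB f (g * g') = g * pB f g' + pB f g * g' := by
  simp only [pB, Derivation.leibniz, Finset.mul_sum, Finset.sum_mul, ← Finset.sum_add_distrib,
    smul_eq_mul]
  exact Finset.sum_congr rfl fun i _ => by ring

theorem pB_C_l (z : K) (g : MvPolynomial (Fin n × Bool) K) : pB (C z) g = 0 := by simp [pB]
theorem pB_C_r (z : K) (g : MvPolynomial (Fin n × Bool) K) : pB g (C z) = 0 := by simp [pB]

theorem pB_C_left (z : K) (f g : MvPolynomial (Fin n × Bool) K) :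
    pB (C z * f) g = C z * pB f g := by
  rw [pB_mul_left, pB_C_l, zero_mul, add_zero]

theorem pB_C_right (z : K) (f g : MvPolynomial (Fin n × Bool) K) :
    pB f (C z * g) = C z * pB f g := by
  rw [pB_mul_right, pB_C_r, zero_mul, add_zero]

noncomputable def star4 (z : K) (f g : MvPolynomial (Fin n × Bool) K) :
    MvPolynomial (Fin n × Bool) K := f * g + C (z ^ 2) * pB f g

theorem star4_assoc (z : K) (hz : z ^ 4 = 0) (f g h : MvPolynomial (Fin n × Bool) K) :
    star4 z (star4 z f g) h = star4 z f (star4 z g h) := by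
  have hz' : (C (z ^ 2) : MvPolynomial (Fin n × Bool) K) * C (z ^ 2) = 0 := by
    rw [← C_mul, ← pow_add, hz, C_0]
  simp only [star4, pB_add_left, pB_add_right, pB_mul_left, pB_mul_right, pB_C_l, pB_C_r]
  linear_combination (pB (pB f g) h - pB f (pB g h)) * hz'

noncomputable def starOp (z : K) (f : MvPolynomial (Fin n × Bool) K) :
    Module.End ℂ (MvPolynomial (Fin n × Bool) K) where
  toFun := star4 z f
  map_add' g h := by simp only [star4, pB_add_right]; ring
  map_smul' r g := by
    simp only [star4, RingHom.id_apply]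
    rw [algebra_compatible_smul K r g, algebra_compatible_smul K r, ← C_mul', pB_C_right, ← C_mul']
    ring

theorem starOp_mul (z : K) (hz : z ^ 4 = 0) (f g : MvPolynomial (Fin n × Bool) K) :
    starOp z f * starOp z g = starOp z (star4 z f g) := by
  refine LinearMap.ext fun h => ?_
  exact (star4_assoc z hz f g h).symm

theorem starOp_add (z : K) (f g : MvPolynomial (Fin n × Bool) K) :
    starOp z f + starOp z g = starOp z (f + g) := by
  refine LinearMap.ext fun h => ?_
  change star4 z f h + star4 z g h = star4 z (f + g) h
  simp only [star4, pB_add_left]; ring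

theorem pB_X_X (a b : Fin n × Bool) : pB (X a : MvPolynomial (Fin n × Bool) K) (X b) =
    if a.2 = false ∧ b = (a.1, true) then 1 else 0 := by
  classical
  obtain ⟨i, s⟩ := a
  simp only [pB, pderiv_X]
  rw [Finset.sum_eq_single i]
  · cases s <;> simp [Pi.single_apply]
  · intro j _ hj
    simp [Pi.single_apply, hj.symm]
  · simp

theorem rees_rho_exists (n : ℕ) (z : K) (hz : z ^ 4 = 0) :
    ∃ F : ReesWeyl n →ₐ[ℂ] Module.End ℂ (MvPolynomial (Fin n × Bool) K),
    ∀ g, F (rGen n g) = starOp z (g.elim (C z) X) := by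
  apply rees_lift_exists
  · intro i
    simp only [starOp_mul z hz, starOp_add, Option.elim, star4, pB_X_X, pB_C_l]
    congr 1
    simp [pow_two]; ring
  · intro a b h h'
    simp only [starOp_mul z hz, star4]
    congr 1
    rcases a with _ | ⟨i, s⟩ <;> rcases b with _ | ⟨j, t⟩ <;>
      simp only [Option.elim, pB_C_l, pB_C_r, pB_X_X] <;> try ring
    have hA : ¬(s = false ∧ (j, t) = (i, true)) := by
      rintro ⟨h1, h2⟩
      simp only [Prod.mk.injEq] at h2
      exact h i ⟨by rw [h1], by rw [h2.1, h2.2]⟩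
    have hB : ¬(t = false ∧ (i, s) = (j, true)) := by
      rintro ⟨h1, h2⟩
      simp only [Prod.mk.injEq] at h2
      exact h' i ⟨by rw [h2.2], by rw [h2.1, h1]⟩
    rw [if_neg hA, if_neg hB]

/-- Existence of the symbol map. -/
theorem rees_sigma_exists (n : ℕ) (z : K) (hz : z ^ 4 = 0) (ev : K →ₐ[ℂ] ℂ) (hev : ev z = 0) :
    ∃ σ : ReesWeyl n →ₗ[ℂ] MvPolynomial (Fin n × Bool) K,
      (∀ a b, σ (a * b) = star4 z (σ a) (σ b)) ∧ σ (rGen n none) = C z ∧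
      ∀ a, MvPolynomial.map (ev : K →+* ℂ) (σ a) = piHom n a := by
  obtain ⟨F, hF⟩ := rees_rho_exists n z hz
  have one_r : ∀ f : MvPolynomial (Fin n × Bool) K, starOp z f 1 = f := by
    intro f
    change star4 z f 1 = f
    rw [star4, ← C_1, pB_C_r]; simp
  have hex : ∀ a, ∃ f, F a = starOp z f := by
    intro a
    induction a using rees_induction with
    | h0 r =>
      refine ⟨C (algebraMap ℂ K r), ?_⟩
      refine LinearMap.ext fun u => ?_
      rw [AlgHom.commutes, Module.algebraMap_end_apply]
      change _ = star4 z _ _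
      rw [star4, pB_C_l, C_mul']; simp
    | h1 g => exact ⟨_, hF g⟩
    | hm a b ha hb =>
      obtain ⟨f, hf⟩ := ha
      obtain ⟨g, hg⟩ := hb
      exact ⟨_, by rw [map_mul, hf, hg, starOp_mul z hz]⟩
    | ha a b ha hb =>
      obtain ⟨f, hf⟩ := ha
      obtain ⟨g, hg⟩ := hb
      exact ⟨_, by rw [map_add, hf, hg, starOp_add]⟩
  let σ : ReesWeyl n →ₗ[ℂ] MvPolynomial (Fin n × Bool) K :=
    (LinearMap.applyₗ (1 : MvPolynomial (Fin n × Bool) K)).comp F.toLinearMap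
  have hσ : ∀ a, F a = starOp z (σ a) := by
    intro a
    obtain ⟨f, hf⟩ := hex a
    have : σ a = f := by
      change F a 1 = f
      rw [hf, one_r]
    rw [this, hf]
  have hmul : ∀ a b, σ (a * b) = star4 z (σ a) (σ b) := by
    intro a b
    change F (a * b) 1 = _
    rw [map_mul, hσ a]
    rfl
  have hgen : ∀ g, σ (rGen n g) = g.elim (C z) X := by
    intro g
    change F _ 1 = _
    rw [hF, one_r]
  refine ⟨σ, hmul, hgen none, ?_⟩
  intro a
  induction a using rees_induction with
  | h0 r =>
    have : σ (algebraMap ℂ _ r) = C (algebraMap ℂ K r) := by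
      change F _ 1 = _
      rw [AlgHom.commutes, Module.algebraMap_end_apply, algebra_compatible_smul K, ← C_mul', mul_one]
    rw [this, AlgHom.commutes]; simp [MvPolynomial.algebraMap_eq]
  | h1 g =>
    rw [hgen, piHom_gen]
    cases g <;> simp [hev]
  | hm a b ha hb => rw [hmul, star4, map_mul, ← ha, ← hb]; simp [hev]
  | ha a b ha hb => rw [map_add, map_add, map_add, ha, hb]

end Star

/-! ### The truncated coefficient ring -/

theorem trunc_exists : ∃ (K : Type) (_ : CommRing K) (_ : Algebra ℂ K) (z : K) (ev : K →ₐ[ℂ] ℂ),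
    z ^ 4 = 0 ∧ ev z = 0 ∧ z ^ 2 ≠ 0 ∧ ∀ k, z ^ 3 * k = 0 → ev k = 0 := by
  let p : Polynomial ℂ := Polynomial.X ^ 4
  let ev : AdjoinRoot p →ₐ[ℂ] ℂ := AdjoinRoot.liftAlgHom p (Algebra.ofId ℂ ℂ) 0 (by simp [p])
  have hroot : AdjoinRoot.root p = AdjoinRoot.mk p Polynomial.X := AdjoinRoot.mk_X.symm
  have hz : AdjoinRoot.root p ^ 4 = 0 := by
    rw [hroot, ← map_pow, AdjoinRoot.mk_eq_zero]
  have h3 : ∀ k, AdjoinRoot.root p ^ 3 * k = 0 → ev k = 0 := by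
    intro k hk
    obtain ⟨q, rfl⟩ := AdjoinRoot.mk_surjective k
    rw [hroot, ← map_pow, ← map_mul, AdjoinRoot.mk_eq_zero] at hk
    have : (Polynomial.X : Polynomial ℂ) ∣ q := by
      rw [show p = Polynomial.X ^ 3 * Polynomial.X from pow_succ _ _] at hk
      exact (mul_dvd_mul_iff_left (pow_ne_zero 3 Polynomial.X_ne_zero)).1 hk
    obtain ⟨r, rfl⟩ := this
    simp [ev]
  refine ⟨AdjoinRoot p, inferInstance, inferInstance, AdjoinRoot.root p, ev, hz, by simp [ev], ?_, h3⟩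
  intro h
  have := h3 1 (by rw [pow_succ, h]; simp)
  simp at this

/-! ### Poisson bracket consequences -/

section Poisson
open MvPolynomial

theorem pB_map {n : ℕ} {K : Type} [CommRing K] (ev : K →+* ℂ)
    (f g : MvPolynomial (Fin n × Bool) K) :
    MvPolynomial.map ev (pB f g) = pB (MvPolynomial.map ev f) (MvPolynomial.map ev g) := by
  simp [pB, pderiv_map]

theorem rees_z_sq_ne {n : ℕ} : rGen n none * rGen n none ≠ 0 := by
  obtain ⟨K, _, _, z, ev, hz, hev, h2, h3⟩ := trunc_exists
  obtain ⟨σ, hmul, hσz, hπ⟩ := rees_sigma_exists n z hz ev hev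
  intro h
  have := hmul (rGen n none) (rGen n none)
  rw [h, hσz, star4, pB_C_l, map_zero, mul_zero, add_zero, ← C_mul] at this
  exact h2 (by rw [pow_two]; exact (C_eq_zero.1 this.symm))

theorem rees_poisson {n : ℕ} (a b c : ReesWeyl n)
    (h : rGen n none * (a * b - b * a) = rGen n none ^ 4 * c) :
    pB (piHom n a) (piHom n b) - pB (piHom n b) (piHom n a) = 0 := by
  obtain ⟨K, _, _, z, ev, hz, hev, h2, h3⟩ := trunc_exists
  obtain ⟨σ, hmul, hσz, hπ⟩ := rees_sigma_exists n z hz ev hev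
  have zmul : ∀ a, σ (rGen n none * a) = C z * σ a := by
    intro a
    rw [hmul, hσz, star4, pB_C_l]; simp
  have h' := congrArg σ h
  rw [zmul, map_sub, hmul, hmul] at h'
  simp only [pow_succ, pow_zero, one_mul, mul_assoc] at h'
  rw [zmul, zmul, zmul, zmul] at h'
  have hz4 : (C z : MvPolynomial (Fin n × Bool) K) ^ 4 = 0 := by rw [← C_pow, hz, C_0]
  have key : C (z ^ 3) * (pB (σ a) (σ b) - pB (σ b) (σ a)) = 0 := by
    simp only [star4, C_pow] at h' ⊢
    linear_combination h' + σ c * hz4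
  rw [← hπ a, ← hπ b, ← pB_map, ← pB_map, ← map_sub]
  ext m
  rw [coeff_map, coeff_zero]
  apply h3
  have := congrArg (coeff m) key
  rwa [coeff_C_mul, coeff_zero] at this

theorem const_of_pderiv {n : ℕ} (f : MvPolynomial (Fin n × Bool) ℂ)
    (h : ∀ v, pderiv v f = 0) : ∃ r, f = C r := by
  classical
  refine ⟨coeff 0 f, ?_⟩
  ext m
  rw [coeff_C]
  split_ifs with hm
  · rw [hm]
  · obtain ⟨v, hv⟩ : ∃ v, m v ≠ 0 := by
      by_contra! hc
      exact hm (by ext v; simp [hc v])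
    have := congrArg (coeff (m - Finsupp.single v 1)) (h v)
    rw [coeff_pderiv, Finsupp.sub_add_single_one_cancel hv, coeff_zero] at this
    rcases mul_eq_zero.1 this with h0 | h0
    · exact h0
    · exact absurd h0 (by norm_cast)

noncomputable def pDer {n : ℕ} (f : MvPolynomial (Fin n × Bool) ℂ) :
    Derivation ℂ (MvPolynomial (Fin n × Bool) ℂ) (MvPolynomial (Fin n × Bool) ℂ) :=
  ∑ i : Fin n, (pderiv (i, false) f • pderiv (i, true) - pderiv (i, true) f • pderiv (i, false))

theorem pDer_apply {n : ℕ} (f g : MvPolynomial (Fin n × Bool) ℂ) :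
    pDer f g = pB f g - pB g f := by
  have : ∀ (s : Finset (Fin n)) (D : Fin n → Derivation ℂ (MvPolynomial (Fin n × Bool) ℂ)
      (MvPolynomial (Fin n × Bool) ℂ)), (∑ i ∈ s, D i) g = ∑ i ∈ s, D i g := by
    intro s D
    rw [← Derivation.coeFnAddMonoidHom_apply, map_sum, Finset.sum_apply]; rfl
  rw [pDer, this, pB, pB, ← Finset.sum_sub_distrib]
  refine Finset.sum_congr rfl fun i _ => ?_
  simp [mul_comm]

theorem const_of_pDer {n : ℕ} (f : MvPolynomial (Fin n × Bool) ℂ)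
    (h : ∀ v, pDer f (X v) = 0) : ∃ r, f = C r := by
  classical
  apply const_of_pderiv
  have e1 : ∀ i : Fin n, pB f (X (i, true)) = pderiv (i, false) f := by
    intro i
    rw [pB, Finset.sum_eq_single i] <;> simp +contextual [pderiv_X, Pi.single_apply, eq_comm]
  have e2 : ∀ i : Fin n, pB (X (i, true)) f = 0 := by
    intro i
    simp [pB, pderiv_X, Pi.single_apply]
  have e3 : ∀ i : Fin n, pB (X (i, false)) f = pderiv (i, true) f := by
    intro i
    rw [pB, Finset.sum_eq_single i] <;> simp +contextual [pderiv_X, Pi.single_apply, eq_comm]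
  have e4 : ∀ i : Fin n, pB f (X (i, false)) = 0 := by
    intro i
    simp [pB, pderiv_X, Pi.single_apply]
  rintro ⟨i, _ | _⟩
  · simpa [pDer_apply, e1, e2] using h (i, true)
  · simpa [pDer_apply, e3, e4] using h (i, false)

theorem der_zero_of_powersums {S ι : Type*} [CommRing S] [IsDomain S] [Algebra ℂ S] [Fintype ι]
    (D : Derivation ℂ S S) (s : ι → S) (h : ∀ k : ℕ, D (∑ i, s i ^ k) = 0) (j : ι) :
    D (s j) = 0 := by
  classical
  haveI : CharZero S := charZero_of_injective_algebraMap (algebraMap ℂ S).injective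
  have h1 : ∀ k : ℕ, ∑ i, s i ^ k * D (s i) = 0 := by
    intro k
    have := h (k + 1)
    rw [map_sum] at this
    simp only [Derivation.leibniz_pow, Nat.add_sub_cancel, smul_eq_mul, nsmul_eq_mul,
      ← Finset.mul_sum] at this
    exact (mul_eq_zero.1 this).resolve_left (by exact_mod_cast Nat.succ_ne_zero k)
  have h2 : ∀ f : Polynomial S, ∑ i, f.eval (s i) * D (s i) = 0 := by
    intro f
    induction f using Polynomial.induction_on' with
    | add p q hp hq => simp [add_mul, Finset.sum_add_distrib, hp, hq]
    | monomial k a =>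
      simp only [Polynomial.eval_monomial, mul_assoc, ← Finset.mul_sum, h1, mul_zero]
  have h3 := h2 (∏ v ∈ (Finset.univ.image s).erase (s j), (Polynomial.X - Polynomial.C v))
  simp only [Polynomial.eval_prod, Polynomial.eval_sub, Polynomial.eval_X, Polynomial.eval_C] at h3
  set q : S → S := fun t => ∏ v ∈ (Finset.univ.image s).erase (s j), (t - v) with hq
  have hq0 : q (s j) ≠ 0 := by
    rw [hq]
    refine Finset.prod_ne_zero_iff.2 fun v hv => ?_
    exact sub_ne_zero.2 (Finset.ne_of_mem_erase hv).symm
  have h4 : ∀ i, q (s i) * D (s i) = if s i = s j then q (s j) * D (s j) else 0 := by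
    intro i
    split_ifs with hi
    · rw [hi]
    · have : q (s i) = 0 := Finset.prod_eq_zero (i := s i) (by simp [hi]) (sub_self _)
      rw [this, zero_mul]
  have h5 : ∑ i, q (s i) * D (s i) = 0 := h3
  rw [Finset.sum_congr rfl fun i _ => h4 i] at h5
  rw [← Finset.sum_filter, Finset.sum_const, nsmul_eq_mul] at h5
  have h6 : ((Finset.univ.filter fun i => s i = s j).card : S) ≠ 0 := by
    have : (Finset.univ.filter fun i => s i = s j).card ≠ 0 :=
      Finset.card_ne_zero_of_mem (a := j) (by simp)
    exact_mod_cast this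
  exact ((mul_eq_zero.1 ((mul_eq_zero.1 h5).resolve_left h6)).resolve_left hq0)

theorem der_zero {n : ℕ} (G : Subgroup (ReesWeyl n ≃ₐ[ℂ] ReesWeyl n)) [Finite G]
    (D : Derivation ℂ (MvPolynomial (Fin n × Bool) ℂ) (MvPolynomial (Fin n × Bool) ℂ))
    (h : ∀ b ∈ fixedSubalgebra G, D (piHom n b) = 0) (b : ReesWeyl n) : D (piHom n b) = 0 := by
  haveI := Fintype.ofFinite G
  refine der_zero_of_powersums D (fun g : G => piHom n (g.1 b)) (fun k => ?_) 1
  have : ∑ g : G, piHom n (g.1 b) ^ k = piHom n (∑ g : G, g.1 (b ^ k)) := by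
    simp only [map_sum, map_pow]
  rw [this]
  apply h
  intro g hg
  rw [map_sum]
  exact Fintype.sum_equiv (Equiv.mulLeft (⟨g, hg⟩ : G)) _ _ (fun x => rfl)

end Poisson

/-! ### The main argument -/

theorem w_form {n : ℕ} (hn : 1 ≤ n) (G : Subgroup (ReesWeyl n ≃ₐ[ℂ] ReesWeyl n)) [Finite G]
    (φ : ReesWeyl n →ₐ[ℂ] ReesWeyl n) (hmem : ∀ a, φ a ∈ fixedSubalgebra G)
    (hsurj : ∀ a ∈ fixedSubalgebra G, ∃ b, φ b = a) :
    ∃ (α : ℂ) (w : ReesWeyl n), α ≠ 0 ∧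
      φ (rGen n none) = α • rGen n none + rGen n none * (rGen n none * w) := by
  have hX : ∀ v, (MvPolynomial.X v : MvPolynomial (Fin n × Bool) ℂ) = piHom n (rGen n (some v)) :=
    fun v => by rw [piHom_gen]; rfl
  have hconst : ∀ a : ReesWeyl n, (∀ b ∈ fixedSubalgebra G, pDer (piHom n a) (piHom n b) = 0) →
      ∃ r, piHom n a = MvPolynomial.C r := by
    intro a h
    apply const_of_pDer
    intro v
    rw [hX]
    exact der_zero G _ h _
  let i0 : Fin n := ⟨0, hn⟩
  have hπw : piHom n (φ (rGen n none)) = 0 := by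
    have h1 := congrArg (fun t => piHom n (φ t)) (rees_weyl i0)
    simp only [map_mul, map_add] at h1
    rw [mul_comm, left_eq_add] at h1
    exact mul_self_eq_zero.1 h1
  obtain ⟨w', hw'⟩ := piHom_ker hπw
  obtain ⟨α, hα⟩ : ∃ r, piHom n w' = MvPolynomial.C r := by
    apply hconst
    intro b hb
    rw [pDer_apply]
    refine rees_poisson w' b 0 ?_
    obtain ⟨b, rfl⟩ := hsurj b hb
    have h2 : φ (rGen n none) * φ b = φ b * φ (rGen n none) := by
      rw [← map_mul, rees_z_central, map_mul]
    rw [hw'] at h2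
    rw [mul_zero, mul_sub, ← mul_assoc, h2, ← mul_assoc, ← mul_assoc, rees_z_central (φ b), sub_self]
  obtain ⟨w'', hw''⟩ : ∃ c, w' - algebraMap ℂ _ α = rGen n none * c := by
    apply piHom_ker
    rw [map_sub, hα, AlgHom.commutes, MvPolynomial.algebraMap_eq, sub_self]
  have hw : φ (rGen n none) = α • rGen n none + rGen n none * (rGen n none * w'') := by
    rw [hw', ← hw'', mul_sub, Algebra.smul_def, Algebra.commutes]
    abel
  refine ⟨α, w'', ?_, hw⟩
  rintro rfl
  rw [zero_smul, zero_add] at hw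
  have hc : ∀ a ∈ fixedSubalgebra G, ∃ r, piHom n a = MvPolynomial.C r := by
    intro a ha
    apply hconst
    intro b hb
    obtain ⟨a, rfl⟩ := hsurj a ha
    obtain ⟨b, rfl⟩ := hsurj b hb
    rw [pDer_apply]
    obtain ⟨c, hc⟩ := rees_comm_mod a b
    refine rees_poisson _ _ (rGen n none * (w'' * (w'' * φ c))) ?_
    rw [← map_mul, ← map_mul, ← map_sub, hc, map_mul, map_mul, hw]
    have e : ∀ t : ReesWeyl n, w'' * (rGen n none * t) = rGen n none * (w'' * t) := by
      intro t
      rw [← mul_assoc, ← rees_z_central, mul_assoc]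
    simp only [pow_succ, pow_zero, one_mul, mul_assoc, e]
  have h0 := der_zero G (MvPolynomial.pderiv (i0, false)) (by
    intro b hb
    obtain ⟨r, hr⟩ := hc b hb
    rw [hr, MvPolynomial.pderiv_C]) (rGen n (some (i0, false)))
  rw [← hX, MvPolynomial.pderiv_X_self] at h0
  exact one_ne_zero h0

theorem ring_br {R : Type*} [Ring R] (a b c d : R) (h : a * b = b * a + c * d) :
    a * b - b * a = c * d := by rw [h, add_sub_cancel_left]

theorem br_gen {n : ℕ} (φ : ReesWeyl n →ₐ[ℂ] ReesWeyl n) (α : ℂ)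
    (h0 : cf 0 (φ (rGen n none)) = 0) (h1 : cf 1 (φ (rGen n none)) = α • rGen n none)
    (i : Fin n) :
    cf 1 (φ (rGen n (some (i, false)))) * cf 1 (φ (rGen n (some (i, true)))) -
    cf 1 (φ (rGen n (some (i, true)))) * cf 1 (φ (rGen n (some (i, false)))) =
      (α * α) • (rGen n none * rGen n none) := by
  rw [← cf_two_comm, ← map_mul, ← map_mul, ← map_sub, ring_br _ _ _ _ (rees_weyl i), map_mul,
    cf_mul_two, h0, h1, zero_mul, mul_zero, zero_add, add_zero, smul_mul_smul_comm]

theorem br_comm {n : ℕ} (φ : ReesWeyl n →ₐ[ℂ] ReesWeyl n) (a b : ReesGen n)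
    (h : ∀ i : Fin n, ¬(a = some (i, false) ∧ b = some (i, true)))
    (h' : ∀ i : Fin n, ¬(a = some (i, true) ∧ b = some (i, false))) :
    cf 1 (φ (rGen n a)) * cf 1 (φ (rGen n b)) -
    cf 1 (φ (rGen n b)) * cf 1 (φ (rGen n a)) = 0 := by
  rw [← cf_two_comm, ← map_mul, ← map_mul, ← map_sub, rees_comm a b h h', sub_self, map_zero]
  simp [cf]

theorem u_indep {n : ℕ} (φ : ReesWeyl n →ₐ[ℂ] ReesWeyl n) (α : ℂ) (hα : α ≠ 0)
    (h0 : cf 0 (φ (rGen n none)) = 0) (h1 : cf 1 (φ (rGen n none)) = α • rGen n none) :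
    LinearIndependent ℂ (fun g => cf 1 (φ (rGen n g))) := by
  classical
  rw [Fintype.linearIndependent_iff]
  intro c hc
  have hsome : ∀ v, c (some v) = 0 := by
    rintro ⟨i, s⟩
    set u := fun g => cf 1 (φ (rGen n g)) with hu
    have hb : ∑ g, c g • (u g * u (some (i, !s)) - u (some (i, !s)) * u g) = 0 := by
      have e1 : (∑ g, c g • u g) * u (some (i, !s)) - u (some (i, !s)) * (∑ g, c g • u g) = 0 := by
        rw [hc, zero_mul, mul_zero, sub_self]
      rw [Finset.sum_mul, Finset.mul_sum, ← Finset.sum_sub_distrib] at e1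
      rw [← e1]
      refine Finset.sum_congr rfl fun g _ => ?_
      rw [smul_mul_assoc, mul_smul_comm, smul_sub]
    rw [Finset.sum_eq_single (some (i, s))] at hb
    · have hne : u (some (i, s)) * u (some (i, !s)) - u (some (i, !s)) * u (some (i, s)) ≠ 0 := by
        have := br_gen φ α h0 h1 i
        have hz : (α * α) • (rGen n none * rGen n none) ≠ 0 :=
          smul_ne_zero (mul_ne_zero hα hα) rees_z_sq_ne
        cases s
        · rw [← this] at hz
          exact hz
        · rw [← this, ← neg_ne_zero, neg_sub] at hz
          exact hz
      exact (smul_eq_zero.1 hb).resolve_right hne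
    · intro g _ hg
      have := br_comm φ g (some (i, !s)) (by
        rintro j ⟨rfl, h⟩
        simp only [Option.some.injEq, Prod.mk.injEq] at h
        obtain ⟨rfl, h⟩ := h
        cases s <;> simp_all) (by
        rintro j ⟨rfl, h⟩
        simp only [Option.some.injEq, Prod.mk.injEq] at h
        obtain ⟨rfl, h⟩ := h
        cases s <;> simp_all)
      rw [hu]
      simp only [this, smul_zero]
    · simp
  rintro (_ | v)
  · simp only [Fintype.sum_option, hsome, zero_smul, Finset.sum_const_zero, add_zero, h1,
      smul_smul] at hc
    have hz : rGen n none ≠ 0 := fun h => rees_z_sq_ne (n := n) (by rw [h, zero_mul])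
    exact (mul_eq_zero.1 ((smul_eq_zero.1 hc).resolve_right hz)).resolve_right hα
  · exact hsome v

theorem stmt1 (n : ℕ) (hn : 1 ≤ n)
    (G : Subgroup (ReesWeyl n ≃ₐ[ℂ] ReesWeyl n)) [Finite G] (hG : G ≠ ⊥)
    (hV : ∀ g ∈ G, (reesV n).map (g : ReesWeyl n ≃ₐ[ℂ] ReesWeyl n).toLinearMap = reesV n) :
    IsEmpty ((fixedSubalgebra G) ≃ₐ[ℂ] ReesWeyl n) := by
  refine ⟨fun e => hG ?_⟩
  let φ : ReesWeyl n →ₐ[ℂ] ReesWeyl n := (fixedSubalgebra G).val.comp e.symm.toAlgHom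
  have hmem : ∀ a, φ a ∈ fixedSubalgebra G := fun a => (e.symm a).2
  have hsurj : ∀ a ∈ fixedSubalgebra G, ∃ b, φ b = a := by
    intro a ha
    refine ⟨e ⟨a, ha⟩, ?_⟩
    change ((e.symm (e ⟨a, ha⟩) : fixedSubalgebra G) : ReesWeyl n) = a
    rw [e.symm_apply_apply]
  obtain ⟨α, w, hα, hw⟩ := w_form hn G φ hmem hsurj
  have h0 : cf 0 (φ (rGen n none)) = 0 := by
    rw [hw, cf_add, cf_smul, cf_mul_zero]; simp [cf_gen]
  have h1 : cf 1 (φ (rGen n none)) = α • rGen n none := by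
    rw [hw, cf_add, cf_smul, cf_mul_one, cf_mul_zero]; simp [cf_gen]
  have hind := u_indep φ α hα h0 h1
  haveI : FiniteDimensional ℂ (reesV n) :=
    FiniteDimensional.span_of_finite ℂ (Set.finite_range _)
  have hspan : Submodule.span ℂ (Set.range fun g => cf 1 (φ (rGen n g))) = reesV n := by
    apply Submodule.eq_of_le_of_finrank_le
    · rw [Submodule.span_le]
      rintro _ ⟨g, rfl⟩
      exact cf_one_mem _
    · rw [finrank_span_eq_card hind]
      exact finrank_range_le_card _
  rw [eq_bot_iff]
  intro g hg
  rw [Subgroup.mem_bot]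
  have hfix : ∀ v ∈ reesV n, g v = v := by
    intro v hv
    rw [← hspan] at hv
    induction hv using Submodule.span_induction with
    | mem x h =>
      obtain ⟨k, rfl⟩ := h
      change g (cf 1 _) = _
      rw [← cf_equiv g (hV g hg), hmem _ g hg]
    | zero => exact map_zero g
    | add x y _ _ hx hy => rw [map_add, hx, hy]
    | smul r x _ hx => rw [map_smul, hx]
  refine AlgEquiv.ext fun a => ?_
  rw [AlgEquiv.one_apply]
  induction a using rees_induction with
  | h0 r => exact g.commutes r
  | h1 k => exact hfix _ (gen_mem_V k)
  | hm a b ha hb => rw [map_mul, ha, hb]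
  | ha a b ha hb => rw [map_add, ha, hb]
end

section
/- Let 𝔤 and 𝔤' be finite-dimensional complex Lie algebras, neither of which has a Lie ideal of dimension 1. If H(𝔤) is isomorphic to H(𝔤') as a ℂ-algebra, then 𝔤 is isomorphic to 𝔤' as a complex Lie algebra. -/
open TensorAlgebra

/-- The defining relations of the homogenization `H(𝔤)` of the universal enveloping
algebra of a Lie algebra `L`, inside the tensor algebra on `L × ℂ`. -/
inductive HomogRel (L : Type) [LieRing L] [LieAlgebra ℂ L] :
    TensorAlgebra ℂ (L × ℂ) → TensorAlgebra ℂ (L × ℂ) → Prop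
  | central (b : L) :
      HomogRel L (ι ℂ ((b, 0) : L × ℂ) * ι ℂ ((0, 1) : L × ℂ))
        (ι ℂ ((0, 1) : L × ℂ) * ι ℂ ((b, 0) : L × ℂ))
  | lie (b c : L) :
      HomogRel L (ι ℂ ((b, 0) : L × ℂ) * ι ℂ ((c, 0) : L × ℂ))
        (ι ℂ ((c, 0) : L × ℂ) * ι ℂ ((b, 0) : L × ℂ) +
          ι ℂ ((⁅b, c⁆, 0) : L × ℂ) * ι ℂ ((0, 1) : L × ℂ))

/-- The homogenization `H(𝔤)` of the universal enveloping algebra of `L`. -/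
abbrev Homog (L : Type) [LieRing L] [LieAlgebra ℂ L] : Type := RingQuot (HomogRel L)

/-- The central element `z` of `H(𝔤)`. -/
noncomputable def homogZ (L : Type) [LieRing L] [LieAlgebra ℂ L] : Homog L :=
  RingQuot.mkAlgHom ℂ (HomogRel L) (ι ℂ ((0, 1) : L × ℂ))

/-- The degree-one subspace `V` of `H(𝔤)`, the image of `𝔤 ⊕ ℂ`. -/
noncomputable def homogV (L : Type) [LieRing L] [LieAlgebra ℂ L] : Submodule ℂ (Homog L) :=
  LinearMap.range ((RingQuot.mkAlgHom ℂ (HomogRel L)).toLinearMap ∘ₗ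
    (ι ℂ : (L × ℂ) →ₗ[ℂ] TensorAlgebra ℂ (L × ℂ)))

namespace HomogAux

variable (L : Type) [LieRing L] [LieAlgebra ℂ L]

/-- The bilinear product `V × V → V` modelling the degree two part. -/
noncomputable def mu : (L × ℂ) →ₗ[ℂ] (L × ℂ) →ₗ[ℂ] (L × ℂ) :=
  LinearMap.mk₂ ℂ (fun v w => ((1 / 2 : ℂ) • ⁅v.1, w.1⁆ + w.2 • v.1 + v.2 • w.1, v.2 * w.2))
    (by intro a b c; ext <;> simp <;> first | module | ring)
    (by intro a b c; ext <;> simp <;> first | module | ring)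
    (by intro a b c; ext <;> simp <;> first | module | ring)
    (by intro a b c; ext <;> simp <;> first | module | ring)

theorem mu_apply (v w : L × ℂ) : mu L v w =
    ((1 / 2 : ℂ) • ⁅v.1, w.1⁆ + w.2 • v.1 + v.2 • w.1, v.2 * w.2) := rfl

theorem mu_comm (v w : L × ℂ) : mu L v w - mu L w v = (⁅v.1, w.1⁆, 0) := by
  rw [mu_apply, mu_apply, ← lie_skew w.1 v.1]
  ext
  · simp [-lie_skew]; module
  · simp; ring

/-- Left action of degree one elements on the truncated model. -/
noncomputable def act : (L × ℂ) →ₗ[ℂ] Module.End ℂ (ℂ × (L × ℂ) × (L × ℂ)) :=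
  LinearMap.mk₂ ℂ (fun v x => (0, x.1 • v, mu L v x.2.1))
    (by intro a b c; ext <;> simp)
    (by intro a b c; ext <;> simp <;> first | module | ring)
    (by intro a b c; ext <;> simp <;> first | module | ring)
    (by intro a b c; ext <;> simp <;> first | module | ring)

theorem act_apply (v : L × ℂ) (x : ℂ × (L × ℂ) × (L × ℂ)) :
    act L v x = (0, x.1 • v, mu L v x.2.1) := rfl

/-- Representation on the truncated model. -/
noncomputable def rho : Homog L →ₐ[ℂ] Module.End ℂ (ℂ × (L × ℂ) × (L × ℂ)) :=
  RingQuot.liftAlgHom ℂ ⟨TensorAlgebra.lift ℂ (act L), by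
    intro x y h
    cases h with
    | central b =>
      refine LinearMap.ext fun x => ?_
      simp [act_apply, mu_apply]
    | lie b c =>
      refine LinearMap.ext fun x => ?_
      have := mu_comm L (b, 0) (c, 0)
      have h2 : mu L (⁅b, c⁆, 0) (0, 1) = (⁅b, c⁆, 0) := by simp [mu_apply]
      rw [← h2] at this
      have h3 := sub_eq_iff_eq_add.1 this
      simp only [map_mul, map_add, TensorAlgebra.lift_ι_apply, LinearMap.add_apply,
        Module.End.mul_apply, act_apply, map_smul, h3, zero_smul]
      simp [add_comm]⟩

/-- The generators of `H`. -/
noncomputable def gen : (L × ℂ) →ₗ[ℂ] Homog L :=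
  (RingQuot.mkAlgHom ℂ (HomogRel L)).toLinearMap ∘ₗ
    (ι ℂ : (L × ℂ) →ₗ[ℂ] TensorAlgebra ℂ (L × ℂ))

theorem gen_central (b : L) : gen L (b, 0) * gen L (0, 1) = gen L (0, 1) * gen L (b, 0) := by
  have := RingQuot.mkAlgHom_rel ℂ (HomogRel.central b)
  simpa [gen] using this

theorem gen_lie (b c : L) : gen L (b, 0) * gen L (c, 0) =
    gen L (c, 0) * gen L (b, 0) + gen L (⁅b, c⁆, 0) * gen L (0, 1) := by
  have := RingQuot.mkAlgHom_rel ℂ (HomogRel.lie b c)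
  simpa [gen] using this

theorem homog_induction {P : Homog L → Prop} (h0 : ∀ r : ℂ, P (algebraMap ℂ _ r))
    (h1 : ∀ v, P (gen L v)) (hm : ∀ a b, P a → P b → P (a * b))
    (ha : ∀ a b, P a → P b → P (a + b)) (x : Homog L) : P x := by
  obtain ⟨y, rfl⟩ := RingQuot.mkAlgHom_surjective ℂ (HomogRel L) x
  induction y using TensorAlgebra.induction with
  | algebraMap r => simpa using h0 r
  | ι v => exact h1 v
  | mul a b iha ihb => rw [map_mul]; exact hm _ _ iha ihb
  | add a b iha ihb => rw [map_add]; exact ha _ _ iha ihb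

theorem rho_gen (v : L × ℂ) : rho L (gen L v) = act L v := by
  simp [rho, gen]

/-- degree zero part -/
noncomputable def ee (h : Homog L) : ℂ := (rho L h (1, 0, 0)).1

/-- degree one part -/
noncomputable def pp (h : Homog L) : L × ℂ := (rho L h (1, 0, 0)).2.1

/-- degree two part -/
noncomputable def qq (h : Homog L) : L × ℂ := (rho L h (1, 0, 0)).2.2

theorem rho_apply (h : Homog L) : ∀ x, rho L h x =
    (ee L h * x.1, ee L h • x.2.1 + x.1 • pp L h,
      ee L h • x.2.2 + x.1 • qq L h + mu L (pp L h) x.2.1) := by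
  induction h using homog_induction with
  | h0 r => intro x; simp [ee, pp, qq, Algebra.algebraMap_eq_smul_one]; rfl
  | h1 v => intro x; simp [ee, pp, qq, rho_gen, act_apply]
  | hm a b iha ihb =>
    intro x
    have e1 : ee L (a * b) = ee L a * ee L b := by
      rw [ee, map_mul, Module.End.mul_apply, ihb, iha]; simp
    have e2 : pp L (a * b) = ee L a • pp L b + ee L b • pp L a := by
      rw [pp, map_mul, Module.End.mul_apply, ihb, iha]; simp
    have e3 : qq L (a * b) = ee L a • qq L b + ee L b • qq L a + mu L (pp L a) (pp L b) := by
      rw [qq, map_mul, Module.End.mul_apply, ihb, iha]; simp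
    rw [map_mul, Module.End.mul_apply, ihb, iha, e1, e2, e3]
    simp only [map_add, map_smul, LinearMap.add_apply, LinearMap.smul_apply]
    refine Prod.ext ?_ (Prod.ext ?_ ?_)
    · simp only; ring
    · simp only; module
    · simp only; module
  | ha a b iha ihb =>
    intro x
    have e1 : ee L (a + b) = ee L a + ee L b := by simp [ee]
    have e2 : pp L (a + b) = pp L a + pp L b := by simp [pp]
    have e3 : qq L (a + b) = qq L a + qq L b := by simp [qq]
    rw [map_add, LinearMap.add_apply, iha, ihb, e1, e2, e3]
    simp only [map_add, LinearMap.add_apply]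
    refine Prod.ext ?_ (Prod.ext ?_ ?_)
    · simp only [Prod.fst_add]; ring
    · simp only [Prod.fst_add, Prod.snd_add]; module
    · simp only [Prod.snd_add]; module

theorem ee_mul (a b : Homog L) : ee L (a * b) = ee L a * ee L b := by
  rw [ee, map_mul, Module.End.mul_apply, rho_apply L b, rho_apply L a]; simp

theorem pp_mul (a b : Homog L) : pp L (a * b) = ee L a • pp L b + ee L b • pp L a := by
  rw [pp, map_mul, Module.End.mul_apply, rho_apply L b, rho_apply L a]; simp

theorem qq_mul (a b : Homog L) :
    qq L (a * b) = ee L a • qq L b + ee L b • qq L a + mu L (pp L a) (pp L b) := by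
  rw [qq, map_mul, Module.End.mul_apply, rho_apply L b, rho_apply L a]; simp

theorem ee_add (a b : Homog L) : ee L (a + b) = ee L a + ee L b := by simp [ee]
theorem pp_add (a b : Homog L) : pp L (a + b) = pp L a + pp L b := by simp [pp]
theorem qq_add (a b : Homog L) : qq L (a + b) = qq L a + qq L b := by simp [qq]
theorem pp_smul (r : ℂ) (b : Homog L) : pp L (r • b) = r • pp L b := by simp [pp]
theorem pp_gen (v : L × ℂ) : pp L (gen L v) = v := by simp [pp, rho_gen, act_apply]
theorem pp_alg (r : ℂ) : pp L (algebraMap ℂ _ r) = 0 := by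
  simp [pp, Algebra.algebraMap_eq_smul_one]

variable (L' : Type) [LieRing L'] [LieAlgebra ℂ L']

noncomputable def dd (φ : Homog L ≃ₐ[ℂ] Homog L') : (L × ℂ) →ₗ[ℂ] (L' × ℂ) where
  toFun v := pp L' (φ (gen L v))
  map_add' a b := by simp [pp_add]
  map_smul' r b := by simp [pp_smul]

theorem dd_apply (φ : Homog L ≃ₐ[ℂ] Homog L') (v) : dd L L' φ v = pp L' (φ (gen L v)) := rfl

theorem dd_surj (φ : Homog L ≃ₐ[ℂ] Homog L') : Function.Surjective (dd L L' φ) := by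
  have key : ∀ h, pp L' (φ h) ∈ LinearMap.range (dd L L' φ) := by
    intro h
    induction h using homog_induction with
    | h0 r => simp [pp_alg]
    | h1 v => exact ⟨v, rfl⟩
    | hm a b iha ihb =>
      rw [map_mul, pp_mul]
      exact add_mem (Submodule.smul_mem _ _ ihb) (Submodule.smul_mem _ _ iha)
    | ha a b iha ihb => rw [map_add, pp_add]; exact add_mem iha ihb
  intro v
  have := key (φ.symm (gen L' v))
  rwa [AlgEquiv.apply_symm_apply, pp_gen] at this

theorem finrank_le [FiniteDimensional ℂ L] [FiniteDimensional ℂ L']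
    (φ : Homog L ≃ₐ[ℂ] Homog L') : Module.finrank ℂ L' ≤ Module.finrank ℂ L := by
  have := LinearMap.finrank_le_finrank_of_surjective (dd_surj L L' φ)
  simpa using this

theorem center_zero [FiniteDimensional ℂ L] (hL : ∀ I : LieIdeal ℂ L, Module.finrank ℂ I ≠ 1)
    (x : L) (hx : ∀ y : L, ⁅x, y⁆ = 0) : x = 0 := by
  by_contra hne
  let I : LieIdeal ℂ L :=
    { Submodule.span ℂ {x} with
      lie_mem := by
        intro y m hm
        obtain ⟨r, rfl⟩ := Submodule.mem_span_singleton.1 hm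
        have : ⁅y, r • x⁆ = 0 := by rw [lie_smul, ← lie_skew, hx]; simp
        rw [this]
        exact zero_mem (Submodule.span ℂ {x}) }
  exact hL I (finrank_span_singleton hne)

end HomogAux

open HomogAux in
theorem stmt2 (L L' : Type) [LieRing L] [LieAlgebra ℂ L] [LieRing L'] [LieAlgebra ℂ L']
    [FiniteDimensional ℂ L] [FiniteDimensional ℂ L']
    (hL : ∀ I : LieIdeal ℂ L, Module.finrank ℂ I ≠ 1)
    (hL' : ∀ I : LieIdeal ℂ L', Module.finrank ℂ I ≠ 1)
    (hiso : Nonempty (Homog L ≃ₐ[ℂ] Homog L')) :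
    Nonempty (L ≃ₗ⁅ℂ⁆ L') := by
  obtain ⟨φ⟩ := hiso
  have hfr : Module.finrank ℂ L = Module.finrank ℂ L' :=
    le_antisymm (finrank_le L' L φ.symm) (finrank_le L L' φ)
  have hsurj := dd_surj L L' φ
  have hinj : Function.Injective (dd L L' φ) :=
    (LinearMap.injective_iff_surjective_of_finrank_eq_finrank (by simp [hfr])).2 hsurj
  have hrel : ∀ b c : L, ee L' (φ (gen L (⁅b, c⁆, 0))) = 0 ∧
      ee L' (φ (gen L (0, 1))) • ⁅b, c⁆ = 0 := by
    intro b c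
    have h := congrArg (fun x => pp L' (φ x)) (gen_lie L b c)
    simp only [map_mul, map_add, pp_mul, pp_add] at h
    have h2 : dd L L' φ (ee L' (φ (gen L (⁅b, c⁆, 0))) • (0, 1) +
        ee L' (φ (gen L (0, 1))) • (⁅b, c⁆, 0)) = 0 := by
      rw [map_add, map_smul, map_smul, dd_apply, dd_apply]
      rw [add_comm (ee L' (φ (gen L (b, 0))) • _)] at h
      exact left_eq_add.1 h
    have h3 := (map_eq_zero_iff _ hinj).1 h2
    have h4 := congrArg Prod.fst h3
    have h5 := congrArg Prod.snd h3
    simp at h4 h5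
    refine ⟨h5, ?_⟩
    rcases h4 with h4 | h4 <;> simp [h4]
  by_cases hz : ee L' (φ (gen L (0, 1))) = 0
  swap
  · have h0 : ∀ x : L, x = 0 := fun x => center_zero L hL x fun y =>
      (smul_eq_zero.1 (hrel x y).2).resolve_left hz
    have e := LinearEquiv.ofFinrankEq L L' hfr
    exact ⟨{ e with
            map_lie' := by
              intro x y
              rw [h0 x, h0 y]
              simp }⟩
  · have hcomm : ∀ v w : L × ℂ, qq L' (φ (gen L v) * φ (gen L w)) =
        qq L' (φ (gen L w) * φ (gen L v)) + (⁅(dd L L' φ v).1, (dd L L' φ w).1⁆, 0) := by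
      intro v w
      rw [qq_mul, qq_mul, ← mu_comm, dd_apply, dd_apply]
      abel
    have hD0 : (dd L L' φ (0, 1)).1 = 0 := by
      refine center_zero L' hL' _ fun y => ?_
      obtain ⟨⟨b, t⟩, hbt⟩ := hsurj (y, 0)
      have h1 := hcomm (0, 1) (b, 0)
      rw [← map_mul φ, ← map_mul φ, gen_central, left_eq_add] at h1
      have h2 : ((b, t) : L × ℂ) = (b, 0) + t • (0, 1) := by simp
      have h3 : y = (dd L L' φ (b, 0)).1 + t • (dd L L' φ (0, 1)).1 := by
        have := congrArg Prod.fst hbt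
        rw [h2, map_add, map_smul] at this
        exact this.symm
      rw [h3, lie_add, lie_smul, lie_self, smul_zero, add_zero]
      exact congrArg Prod.fst h1
    obtain ⟨k, hk⟩ : ∃ k, dd L L' φ (0, 1) = (0, k) := ⟨_, Prod.ext hD0 rfl⟩
    have hk0 : k ≠ 0 := by
      rintro rfl
      have := (map_eq_zero_iff _ hinj).1 hk
      simp at this
    let α : L →ₗ[ℂ] L' := LinearMap.fst ℂ L' ℂ ∘ₗ dd L L' φ ∘ₗ LinearMap.inl ℂ L ℂ
    have hα : ∀ b, α b = (dd L L' φ (b, 0)).1 := fun _ => rfl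
    have hαlie : ∀ b c, ⁅α b, α c⁆ = k • α ⁅b, c⁆ := by
      intro b c
      have h1 := hcomm (b, 0) (c, 0)
      rw [← map_mul, gen_lie, map_add, qq_add, map_mul, add_right_inj, map_mul, qq_mul,
        (hrel b c).1, hz, ← dd_apply, ← dd_apply, hk, mu_apply] at h1
      have h2 := congrArg Prod.fst h1
      simp at h2
      rw [hα, hα, hα, ← h2]
    have hαinj : Function.Injective α := by
      rw [injective_iff_map_eq_zero]
      intro b hb
      have h1 : dd L L' φ (k • (b, 0) - (dd L L' φ (b, 0)).2 • (0, 1)) = 0 := by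
        rw [map_sub, map_smul, map_smul, hk]
        rw [hα] at hb
        ext
        · simp [hb]
        · simp; ring
      have h2 := congrArg Prod.fst ((map_eq_zero_iff _ hinj).1 h1)
      simpa [hk0] using h2
    let β : L →ₗ[ℂ] L' := k⁻¹ • α
    have hβ : ∀ b, β b = k⁻¹ • α b := fun _ => rfl
    have hβinj : Function.Injective β := fun a b h =>
      hαinj (smul_right_injective L' (inv_ne_zero hk0) h)
    let e := LinearEquiv.ofInjectiveOfFinrankEq β hβinj hfr
    exact ⟨{ e with
            map_lie' := by
              intro x y
              change β ⁅x, y⁆ = ⁅β x, β y⁆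
              simp only [hβ, smul_lie, lie_smul, hαlie, smul_smul]
              congr 1
              field_simp }⟩
end

section
/- Let x_1, …, x_7 be complex roots of unity, none equal to 1, none equal to −1, and such that no two of them sum to 0 (x_i + x_j ≠ 0 for all i ≠ j). Then x_1 + x_2 + ⋯ + x_7 ≠ 3. -/
open Polynomial in
theorem aux_nextCoeff (n : ℕ) (hn : 0 < n) :
    -(cyclotomic n ℚ).nextCoeff = (ArithmeticFunction.moebius n : ℚ) := by
  have h1 : ∀ n > 0, ∑ d ∈ n.divisors, -(cyclotomic d ℚ).nextCoeff = if n = 1 then 1 else 0 := by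
    intro n hn
    rw [Finset.sum_neg_distrib, ← Monic.nextCoeff_prod _ _ (fun i _ => cyclotomic.monic i ℚ),
      prod_cyclotomic_eq_X_pow_sub_one hn]
    have hd : (X ^ n - 1 : ℚ[X]).natDegree = n := by
      simpa using natDegree_X_pow_sub_C (R := ℚ) (n := n) (r := 1)
    rw [nextCoeff_of_natDegree_pos (by omega), hd]
    rcases eq_or_ne n 1 with rfl | h
    · simp
    · have : n - 1 ≠ 0 := by omega
      have h3 : ¬ (n - 1 = n) := by omega
      simp [coeff_X_pow, h, h3, coeff_one, this]
  have h2 : ∀ n > 0, ∑ d ∈ n.divisors, (ArithmeticFunction.moebius d : ℚ) = if n = 1 then 1 else 0 := by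
    intro n hn
    have := congrArg (fun f : ArithmeticFunction ℤ => (f n : ℚ))
      ArithmeticFunction.coe_zeta_mul_moebius
    simp only [ArithmeticFunction.coe_zeta_mul_apply, ArithmeticFunction.one_apply] at this
    push_cast at this
    exact this
  induction n using Nat.strong_induction_on with
  | _ n ih =>
    have e := (h1 n hn).trans (h2 n hn).symm
    rw [← Nat.cons_self_properDivisors hn.ne', Finset.sum_cons, Finset.sum_cons] at e
    have e2 : ∑ d ∈ n.properDivisors, -(cyclotomic d ℚ).nextCoeff
        = ∑ d ∈ n.properDivisors, (ArithmeticFunction.moebius d : ℚ) := by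
      refine Finset.sum_congr rfl fun d hd => ih d (Nat.mem_properDivisors.1 hd).2 ?_
      exact Nat.pos_of_dvd_of_pos (Nat.mem_properDivisors.1 hd).1 hn
    linarith

theorem aux_tot (n : ℕ) (hn : 0 < n) (h : n.totient ≤ 4) : n ∣ 120 := by
  have key : ∀ m, m ∣ n → m.totient ≤ 4 := fun m hm =>
    (Nat.le_of_dvd (Nat.totient_pos.2 hn) (Nat.totient_dvd_of_dvd hm)).trans h
  rw [Nat.dvd_iff_prime_pow_dvd_dvd]
  intro p k hp hk
  rcases k.eq_zero_or_pos with rfl | hk0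
  · simp
  have hp5 : p ≤ 5 := by
    have := key p ((dvd_pow_self p hk0.ne').trans hk)
    rw [Nat.totient_prime hp] at this
    omega
  have h16 : ¬ (16 ∣ n) := fun h => by have := key _ h; revert this; decide
  have h9 : ¬ (9 ∣ n) := fun h => by have := key _ h; revert this; decide
  have h25 : ¬ (25 ∣ n) := fun h => by have := key _ h; revert this; decide
  have h2 := hp.two_le
  interval_cases p
  · have : k ≤ 3 := by
      by_contra hc
      exact h16 ((pow_dvd_pow 2 (show 4 ≤ k by omega)).trans hk)
    exact (pow_dvd_pow 2 this).trans (by norm_num)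
  · have : k ≤ 1 := by
      by_contra hc
      exact h9 ((pow_dvd_pow 3 (show 2 ≤ k by omega)).trans hk)
    exact (pow_dvd_pow 3 this).trans (by norm_num)
  · exact absurd hp (by decide)
  · have : k ≤ 1 := by
      by_contra hc
      exact h25 ((pow_dvd_pow 5 (show 2 ≤ k by omega)).trans hk)
    exact (pow_dvd_pow 5 this).trans (by norm_num)

theorem aux_mu (n : ℕ) (hn : 1 < n) : 
    (n = 6 ∧ (ArithmeticFunction.moebius n : ℚ) / n.totient ≤ 1 / 2) ∨
    (n = 10 ∧ (ArithmeticFunction.moebius n : ℚ) / n.totient ≤ 1 / 4) ∨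
    (ArithmeticFunction.moebius n : ℚ) / n.totient < 1 / 4 := by
  have h0 : (0:ℚ) < n.totient := by exact_mod_cast Nat.totient_pos.2 (by omega)
  have hm : (ArithmeticFunction.moebius n : ℚ) ≤ 1 := by
    exact_mod_cast (le_abs_self _).trans (ArithmeticFunction.abs_moebius_le_one (n := n))
  by_cases h : n.totient ≤ 4
  · have hd := aux_tot n (by omega) h
    have hle := Nat.le_of_dvd (by norm_num) hd
    have hlist : n ∈ ({2,3,4,5,6,8,10,12} : Finset ℕ) := by
      have : ∀ n ∈ Nat.divisors 120, 1 < n → n.totient ≤ 4 → n ∈ ({2,3,4,5,6,8,10,12} : Finset ℕ) := by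
        decide +kernel
      exact this n (by simp [hd]) hn h
    have prm : ∀ p, p.Prime → (ArithmeticFunction.moebius p : ℚ) = -1 := fun p hp => by
      rw [ArithmeticFunction.moebius_apply_prime hp]; simp
    have nsq : ∀ m, ¬ Squarefree m → (ArithmeticFunction.moebius m : ℚ) = 0 := fun m hp => by
      rw [ArithmeticFunction.moebius_eq_zero_of_not_squarefree hp]; simp
    have t6 : Nat.totient 6 = 2 := by decide
    have t10 : Nat.totient 10 = 4 := by decide
    simp only [Finset.mem_insert, Finset.mem_singleton] at hlist
    have hpr : Nat.Prime n → (ArithmeticFunction.moebius n : ℚ) / n.totient < 1 / 4 := fun hp => by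
      rw [prm n hp, div_lt_iff₀ h0]; linarith
    have hns : ¬ Squarefree n → (ArithmeticFunction.moebius n : ℚ) / n.totient < 1 / 4 := fun hp => by
      rw [nsq n hp]; norm_num
    rcases hlist with rfl | rfl | rfl | rfl | rfl | rfl | rfl | rfl
    · exact .inr (.inr (hpr (by norm_num)))
    · exact .inr (.inr (hpr (by norm_num)))
    · exact .inr (.inr (hns (by decide)))
    · exact .inr (.inr (hpr (by norm_num)))
    · refine .inl ⟨rfl, ?_⟩
      rw [t6]; push_cast; linarith
    · exact .inr (.inr (hns (by decide)))
    · refine .inr (.inl ⟨rfl, ?_⟩)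
      rw [t10]; push_cast; linarith
    · exact .inr (.inr (hns (by decide)))
  · refine .inr (.inr ?_)
    have : (5:ℚ) ≤ n.totient := by exact_mod_cast (by omega : 5 ≤ n.totient)
    rw [div_lt_iff₀ h0]; linarith

/-- A ℚ-linear functional, on the algebraic numbers. -/
theorem aux_trace {K : Type*} [Field K] [CharZero K] [Algebra.IsAlgebraic ℚ K] (x : K) (m : ℕ) (hm : 1 ≤ m)
    (hx : x ^ m = 1) (h1 : x ≠ 1) :
    (x ^ 2 - x + 1 = 0 ∧ Algebra.normalizedTrace ℚ K x ≤ 1 / 2) ∨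
    (x ^ 10 = 1 ∧ Algebra.normalizedTrace ℚ K x ≤ 1 / 4) ∨
    (Algebra.normalizedTrace ℚ K x < 1 / 4) := by
  have hp := IsPrimitiveRoot.orderOf x
  have h0 : 0 < orderOf x := orderOf_pos_iff.2 (isOfFinOrder_iff_pow_eq_one.2 ⟨m, hm, hx⟩)
  have hne : orderOf x ≠ 1 := by rwa [Ne, orderOf_eq_one_iff]
  have ht : Algebra.normalizedTrace ℚ K x
      = (ArithmeticFunction.moebius (orderOf x) : ℚ) / (orderOf x).totient := by
    rw [Algebra.normalizedTrace_minpoly, ← Polynomial.cyclotomic_eq_minpoly_rat hp h0,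
      aux_nextCoeff _ h0, Polynomial.natDegree_cyclotomic, smul_eq_mul, div_eq_inv_mul]
  rw [ht]
  rcases aux_mu _ (show 1 < orderOf x by omega) with ⟨h, h'⟩ | ⟨h, h'⟩ | h'
  · refine .inl ⟨?_, h'⟩
    rw [h] at hp
    have := hp.isRoot_cyclotomic (by norm_num)
    simpa [Polynomial.cyclotomic_six] using this
  · refine .inr (.inl ⟨?_, h'⟩)
    rw [← h]; exact pow_orderOf_eq_one x
  · exact .inr (.inr h')

theorem aux_sum {ι : Type*} [DecidableEq ι] (x : ι → ℂ) (S : Finset ι)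
    (h : ∀ i ∈ S, x i ^ 2 - x i + 1 = 0) : ∃ d : ℤ, (2 ∣ d - S.card) ∧
      (∑ i ∈ S, x i).re = S.card / 2 ∧ (∑ i ∈ S, x i).im = d * √3 / 2 := by
  induction S using Finset.induction_on with
  | empty => exact ⟨0, by simp⟩
  | insert a S ha ih =>
    obtain ⟨d, hd, hr, hi⟩ := ih (fun i hi => h i (by simp [hi]))
    have h3 : √3 ^ 2 = (3:ℝ) := Real.sq_sqrt (by norm_num)
    have e := h a (by simp)
    have hre := congrArg Complex.re e
    have him := congrArg Complex.im e
    simp [pow_two] at hre him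
    have hp : √3 > 0 := by positivity
    have hr2 : (x a).re = 1 / 2 := by
      have : (x a).im * (2 * (x a).re - 1) = 0 := by linarith
      rcases mul_eq_zero.1 this with h | h
      · rw [h] at hre; nlinarith [sq_nonneg ((x a).re - 1/2)]
      · linarith
    have hi2 : (x a).im = √3 / 2 ∨ (x a).im = - (√3 / 2) := by
      apply sq_eq_sq_iff_eq_or_eq_neg.1
      rw [hr2] at hre
      nlinarith
    rw [Finset.sum_insert ha, Finset.card_insert_of_notMem ha]
    rcases hi2 with h | h
    · refine ⟨d + 1, by push_cast; omega, ?_, ?_⟩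
      · simp only [Complex.add_re, hr, hr2]; push_cast; ring
      · simp only [Complex.add_im, hi, h]; push_cast; ring
    · refine ⟨d - 1, by push_cast; omega, ?_, ?_⟩
      · simp only [Complex.add_re, hr, hr2]; push_cast; ring
      · simp only [Complex.add_im, hi, h]; push_cast; ring

theorem aux_unit (x : ℂ) (m : ℕ) (hm : 1 ≤ m) (hx : x ^ m = 1) : x.re ^ 2 + x.im ^ 2 = 1 := by
  have := Complex.norm_eq_one_of_pow_eq_one hx (by omega)
  have h2 := Complex.sq_norm x
  rw [this, Complex.normSq_apply] at h2
  linarith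

theorem aux_two (x y : ℂ) (hx : x ^ 10 = 1) (hy : y ^ 10 = 1) (d : ℤ) (hd : 2 ∣ d - 5)
    (hr : x.re + y.re = 1 / 2) (hi : x.im + y.im = - (d * √3 / 2)) : False := by
  have h3 : √3 ^ 2 = (3:ℝ) := Real.sq_sqrt (by norm_num)
  have ux := aux_unit x 10 (by norm_num) hx
  have uy := aux_unit y 10 (by norm_num) hy
  have e : (x.re + y.re) ^ 2 + (x.im + y.im) ^ 2 = 1 / 4 + 3 * d ^ 2 / 4 := by
    rw [hr, hi]; linear_combination (d:ℝ) ^ 2 / 4 * h3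
  have le : (d:ℝ) ^ 2 ≤ 5 := by
    nlinarith [sq_nonneg (x.re - y.re), sq_nonneg (x.im - y.im)]
  have le' : d ^ 2 ≤ 5 := by exact_mod_cast le
  have h1 : d ≤ 2 := by nlinarith
  have h2 : -2 ≤ d := by nlinarith
  have hd1 : d ^ 2 = 1 := by
    have : d = 1 ∨ d = -1 := by omega
    rcases this with rfl | rfl <;> norm_num
  have hd1' : (d:ℝ) ^ 2 = 1 := by exact_mod_cast hd1
  rw [hd1'] at e
  have hdot : x.re * y.re + x.im * y.im = - 1 / 2 := by linarith
  let z := x * (starRingEnd ℂ) y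
  have hz10 : z ^ 10 = 1 := by
    simp only [z]; rw [mul_pow, hx, ← map_pow, hy]; simp
  have hzr : z.re = -1 / 2 := by simp [z]; linarith
  have uz := aux_unit z 10 (by norm_num) hz10
  have hq : z ^ 2 + z + 1 = 0 := by
    apply Complex.ext
    · simp [pow_two]; rw [hzr] at *; nlinarith
    · simp [pow_two]; rw [hzr]; ring
  have hz3 : z ^ 3 = 1 := by linear_combination (z - 1) * hq
  have hz1 : z = 1 := by
    calc z = z * (z ^ 3) ^ 3 := by rw [hz3]; simp
      _ = z ^ 10 := by ring
      _ = 1 := hz10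
  rw [hz1] at hzr
  norm_num at hzr

theorem stmt10 (x : Fin 7 → ℂ)
    (hroot : ∀ i, ∃ m : ℕ, 1 ≤ m ∧ x i ^ m = 1)
    (hne1 : ∀ i, x i ≠ 1)
    (hnem1 : ∀ i, x i ≠ -1)
    (hpair : ∀ i j, i ≠ j → x i + x j ≠ 0) :
    ∑ i, x i ≠ 3 := by
  intro hsum
  let K := algebraicClosure ℚ ℂ
  have halg : ∀ i, x i ∈ K := fun i => by
    obtain ⟨m, hm, h⟩ := hroot i
    rw [mem_algebraicClosure_iff]
    exact (IsIntegral.of_pow (by omega) (h ▸ isIntegral_one) : IsIntegral ℚ (x i)).isAlgebraic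
  haveI : Algebra.IsAlgebraic ℚ K := algebraicClosure.isAlgebraic ℚ ℂ
  let y : Fin 7 → K := fun i => ⟨x i, halg i⟩
  let t : Fin 7 → ℚ := fun i => Algebra.normalizedTrace ℚ K (y i)
  have hysum : ∑ i, y i = algebraMap ℚ K 3 := by
    apply Subtype.ext
    rw [IntermediateField.coe_sum]
    exact hsum.trans (map_ofNat (algebraMap ℚ ℂ) 3).symm
  have htsum : ∑ i, t i = 3 := by
    simp only [t]
    rw [← map_sum, hysum, Algebra.normalizedTrace_algebraMap_apply]
    simp
  have hcases : ∀ i, (x i ^ 2 - x i + 1 = 0 ∧ t i ≤ 1 / 2) ∨ (x i ^ 10 = 1 ∧ t i ≤ 1 / 4) ∨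
      t i < 1 / 4 := fun i => by
    obtain ⟨m, hm, h⟩ := hroot i
    have := aux_trace (y i) m hm (Subtype.ext (by simpa [y] using h))
      (fun h => hne1 i (by simpa [y] using congrArg Subtype.val h))
    rcases this with ⟨h, h'⟩ | ⟨h, h'⟩ | h
    · exact .inl ⟨by simpa [y] using congrArg Subtype.val h, h'⟩
    · exact .inr (.inl ⟨by simpa [y] using congrArg Subtype.val h, h'⟩)
    · exact .inr (.inr h)
  clear_value t
  classical
  let S : Finset (Fin 7) := Finset.univ.filter fun i => x i ^ 2 - x i + 1 = 0
  have hS : ∀ i ∈ S, x i ^ 2 - x i + 1 = 0 := fun i hi => (Finset.mem_filter.1 hi).2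
  have hSc : ∀ i ∈ Sᶜ, ¬ x i ^ 2 - x i + 1 = 0 := fun i hi h =>
    Finset.mem_compl.1 hi (Finset.mem_filter.2 ⟨Finset.mem_univ _, h⟩)
  have b1 : ∀ i ∈ S, t i ≤ 1 / 2 := fun i _ => by
    rcases hcases i with h | h | h <;> linarith
  have b2 : ∀ i ∈ Sᶜ, t i ≤ 1 / 4 := fun i hi => by
    rcases hcases i with h | h | h
    · exact absurd h.1 (hSc i hi)
    · exact h.2
    · exact h.le
  have s1 := Finset.sum_le_card_nsmul S t _ b1
  have s2 := Finset.sum_le_card_nsmul Sᶜ t _ b2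
  have hcard : S.card + Sᶜ.card = 7 := by simp
  obtain ⟨d, hd, hr, hi⟩ := aux_sum x S hS
  have split := Finset.sum_add_sum_compl S t
  have splitx := Finset.sum_add_sum_compl S x
  rw [hsum] at splitx
  have sre := congrArg Complex.re splitx
  have sim := congrArg Complex.im splitx
  rw [Complex.add_re, hr] at sre
  rw [Complex.add_im, hi] at sim
  rw [htsum] at split
  simp only [nsmul_eq_mul] at s1 s2
  have hcq : (S.card : ℚ) + Sᶜ.card = 7 := by exact_mod_cast hcard
  have hc2 : Sᶜ.card ≤ 2 := by
    have : (Sᶜ.card : ℚ) ≤ 2 := by linarith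
    exact_mod_cast this
  have h3 : √3 ^ 2 = (3:ℝ) := Real.sq_sqrt (by norm_num)
  interval_cases hc : Sᶜ.card
  · have : S.card = 7 := by omega
    rw [Finset.card_eq_zero.1 hc, this] at sre
    norm_num at sre
  · have h6 : S.card = 6 := by omega
    obtain ⟨j, hj⟩ := Finset.card_eq_one.1 hc
    rw [hj, h6] at sre
    rw [hj] at sim
    simp at sre sim
    obtain ⟨m, hm, h⟩ := hroot j
    have u := aux_unit _ m hm h
    have r0 : (x j).re = 0 := by linarith
    have i0 : (x j).im = -(d * √3 / 2) := by linarith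
    rw [r0, i0] at u
    have : (3:ℝ) * d ^ 2 = 4 := by
      linear_combination 4 * u - (d:ℝ) ^ 2 * h3
    have : 3 * d ^ 2 = 4 := by exact_mod_cast this
    omega
  · have h5 : S.card = 5 := by omega
    obtain ⟨j, l, hjl, hj⟩ := Finset.card_eq_two.1 hc
    rw [h5] at s1 sre hd
    rw [hj, Finset.sum_pair hjl] at sre sim split
    simp at sre sim
    have bj := b2 j (by simp [hj])
    have bl := b2 l (by simp [hj])
    norm_num at s1
    have hj10 : x j ^ 10 = 1 := by
      rcases hcases j with h | h | h
      · exact absurd h.1 (hSc j (by simp [hj]))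
      · exact h.1
      · linarith
    have hl10 : x l ^ 10 = 1 := by
      rcases hcases l with h | h | h
      · exact absurd h.1 (hSc l (by simp [hj]))
      · exact h.1
      · linarith
    exact aux_two _ _ hj10 hl10 d (by exact_mod_cast hd) (by linarith) (by linarith)
end

section
/- Let A = ℂ⟨x, y⟩/(x² − y²) and let h be the ℂ-algebra automorphism of A determined by h(x) = −x and h(y) = y. Then the fixed subalgebra A^h = {a ∈ A : h(a) = a} is not isomorphic to A as a ℂ-algebra. -/
/-- The defining relation `x² = y²` of `A = ℂ⟨x, y⟩/(x² − y²)`. -/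
inductive MinusRel : FreeAlgebra ℂ (Fin 2) → FreeAlgebra ℂ (Fin 2) → Prop
  | rel : MinusRel (FreeAlgebra.ι ℂ (0 : Fin 2) * FreeAlgebra.ι ℂ (0 : Fin 2))
      (FreeAlgebra.ι ℂ (1 : Fin 2) * FreeAlgebra.ι ℂ (1 : Fin 2))

/-- The algebra `A = ℂ⟨x, y⟩/(x² − y²)`. -/
abbrev MinusAlg : Type := RingQuot MinusRel

/-- The image of `x` in `A = ℂ⟨x, y⟩/(x² − y²)`. -/
noncomputable def mX : MinusAlg := RingQuot.mkAlgHom ℂ MinusRel (FreeAlgebra.ι ℂ (0 : Fin 2))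

/-- The image of `y` in `A = ℂ⟨x, y⟩/(x² − y²)`. -/
noncomputable def mY : MinusAlg := RingQuot.mkAlgHom ℂ MinusRel (FreeAlgebra.ι ℂ (1 : Fin 2))

/-- The fixed subalgebra `A^g` of a single algebra automorphism `g` of `A`. -/
def fixedSubalgebra1 {A : Type*} [Semiring A] [Algebra ℂ A]
    (g : A ≃ₐ[ℂ] A) : Subalgebra ℂ A where
  carrier := {a | g a = a}
  mul_mem' := by
    intro a b ha hb
    show g (a * b) = a * b
    rw [map_mul, ha, hb]
  add_mem' := by
    intro a b ha hb
    show g (a + b) = a + b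
    rw [map_add, ha, hb]
  algebraMap_mem' := fun r => g.commutes r

open Polynomial in
/-- The images of the generators under the two-dimensional representations. -/
noncomputable def repGen (s : ℂ) : Fin 2 → Matrix (Fin 2) (Fin 2) ℂ[X] :=
  ![!![0, X; X, 0], !![X, 0; 0, C s * X]]

open Polynomial in
/-- The two-dimensional representation with parameter `s`, `s² = 1`. -/
noncomputable def rep (s : ℂ) (hs : s * s = 1) : MinusAlg →ₐ[ℂ] Matrix (Fin 2) (Fin 2) ℂ[X] :=
  RingQuot.liftAlgHom ℂ ⟨FreeAlgebra.lift ℂ (repGen s), by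
    rintro _ _ ⟨⟩
    have h1 : (C s * X * (C s * X) : ℂ[X]) = X * X := by
      have : (C s * C s : ℂ[X]) = 1 := by rw [← C_mul, hs, C_1]
      linear_combination (X * X) * this
    simp [repGen, h1]⟩

theorem rep_X (s : ℂ) (hs : s * s = 1) :
    rep s hs mX = !![0, Polynomial.X; Polynomial.X, 0] := by
  simp [rep, mX, repGen]

theorem rep_Y (s : ℂ) (hs : s * s = 1) :
    rep s hs mY = !![Polynomial.X, 0; 0, Polynomial.C s * Polynomial.X] := by
  simp [rep, mY, repGen]

theorem minus_induction {P : MinusAlg → Prop} (hC : ∀ r, P (algebraMap ℂ _ r))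
    (hX : P mX) (hY : P mY) (hadd : ∀ a b, P a → P b → P (a + b))
    (hmul : ∀ a b, P a → P b → P (a * b)) (a : MinusAlg) : P a := by
  obtain ⟨w, rfl⟩ := RingQuot.mkAlgHom_surjective ℂ MinusRel a
  induction w using FreeAlgebra.induction with
  | grade0 r => simpa using hC r
  | grade1 i => fin_cases i; exacts [hX, hY]
  | mul a b ha hb => rw [map_mul]; exact hmul _ _ ha hb
  | add a b ha hb => rw [map_add]; exact hadd _ _ ha hb

theorem rep_h (h : MinusAlg ≃ₐ[ℂ] MinusAlg) (hx : h mX = - mX) (hy : h mY = mY)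
    (s : ℂ) (hs : s * s = 1) (a : MinusAlg) :
    rep s hs (h a) 0 0 = rep s hs a 0 0 ∧ rep s hs (h a) 1 1 = rep s hs a 1 1 ∧
    rep s hs (h a) 0 1 = - rep s hs a 0 1 ∧ rep s hs (h a) 1 0 = - rep s hs a 1 0 := by
  induction a using minus_induction with
  | hC r => simp [Matrix.algebraMap_matrix_apply]
  | hX => simp [hx, rep_X]
  | hY => simp [hy, rep_Y]
  | hadd a b ha hb =>
    obtain ⟨a1, a2, a3, a4⟩ := ha
    obtain ⟨b1, b2, b3, b4⟩ := hb
    simp only [map_add, Matrix.add_apply, a1, a2, a3, a4, b1, b2, b3, b4]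
    refine ⟨trivial, trivial, ?_, ?_⟩ <;> rw [neg_add]
  | hmul a b ha hb =>
    obtain ⟨a1, a2, a3, a4⟩ := ha
    obtain ⟨b1, b2, b3, b4⟩ := hb
    simp only [map_mul, Matrix.mul_apply, Fin.sum_univ_two, a1, a2, a3, a4, b1, b2, b3, b4]
    refine ⟨?_, ?_, ?_, ?_⟩ <;> ring

open Polynomial in
theorem rep_congr (s t : ℂ) (hs : s * s = 1) (ht : t * t = 1) (a : MinusAlg) :
    (X : ℂ[X]) ∣ rep s hs a 0 1 ∧ (X : ℂ[X]) ∣ rep t ht a 0 1 ∧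
    (X : ℂ[X]) ∣ rep s hs a 1 0 ∧ (X : ℂ[X]) ∣ rep t ht a 1 0 ∧
    (X ^ 2 : ℂ[X]) ∣ rep s hs a 0 0 - rep t ht a 0 0 := by
  induction a using minus_induction with
  | hC r => simp [Matrix.algebraMap_matrix_apply]
  | hX => simp [rep_X]
  | hY => simp [rep_Y]
  | hadd a b ha hb =>
    obtain ⟨a1, a2, a3, a4, a5⟩ := ha
    obtain ⟨b1, b2, b3, b4, b5⟩ := hb
    simp only [map_add, Matrix.add_apply]
    refine ⟨dvd_add a1 b1, dvd_add a2 b2, dvd_add a3 b3, dvd_add a4 b4, ?_⟩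
    convert dvd_add a5 b5 using 1
    ring
  | hmul a b ha hb =>
    obtain ⟨⟨a1, h1⟩, ⟨a2, h2⟩, ⟨a3, h3⟩, ⟨a4, h4⟩, ⟨a5, h5⟩⟩ := ha
    obtain ⟨⟨b1, k1⟩, ⟨b2, k2⟩, ⟨b3, k3⟩, ⟨b4, k4⟩, ⟨b5, k5⟩⟩ := hb
    have h5' := eq_add_of_sub_eq h5
    have k5' := eq_add_of_sub_eq k5
    simp only [map_mul, Matrix.mul_apply, Fin.sum_univ_two, h1, h2, h3, h4, k1, k2, k3, k4]
    refine ⟨?_, ?_, ?_, ?_, ?_⟩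
    · exact ⟨rep s hs a 0 0 * b1 + a1 * rep s hs b 1 1, by ring⟩
    · exact ⟨rep t ht a 0 0 * b2 + a2 * rep t ht b 1 1, by ring⟩
    · exact ⟨a3 * rep s hs b 0 0 + rep s hs a 1 1 * b3, by ring⟩
    · exact ⟨a4 * rep t ht b 0 0 + rep t ht a 1 1 * b4, by ring⟩
    · rw [h5', k5']
      exact ⟨X ^ 2 * a5 * b5 + a5 * rep t ht b 0 0 + rep t ht a 0 0 * b5 + a1 * b3 - a2 * b4,
        by ring⟩

open Polynomial in
/-- The character of the fixed ring given by the upper left entry of the representation. -/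
noncomputable def chi (h : MinusAlg ≃ₐ[ℂ] MinusAlg) (hx : h mX = - mX) (hy : h mY = mY)
    (s : ℂ) (hs : s * s = 1) : fixedSubalgebra1 h →ₐ[ℂ] ℂ[X] where
  toFun b := rep s hs b.1 0 0
  map_one' := by simp
  map_zero' := by simp
  map_add' a b := by simp
  map_mul' a b := by
    have h0 := (rep_h h hx hy s hs a.1).2.2.1
    have ha : h a.1 = a.1 := a.2
    rw [ha, self_eq_neg] at h0
    simp [Matrix.mul_apply, Fin.sum_univ_two, h0]
  commutes' r := by
    simp [Matrix.algebraMap_matrix_apply]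

open Polynomial in
theorem degree_bound (f : MinusAlg →ₐ[ℂ] ℂ[X]) (a : MinusAlg) (ha : f a = X) :
    (f mX).natDegree ≤ 1 ∧ (f mY).natDegree ≤ 1 := by
  have hxy : mX * mX = mY * mY := by
    have := RingQuot.mkAlgHom_rel ℂ MinusRel.rel
    simpa [mX, mY] using this
  have h2 : f mX * f mX = f mY * f mY := by rw [← map_mul, hxy, map_mul]
  have h3 := mul_self_eq_mul_self_iff.1 h2
  have key : ∀ c : MinusAlg, ∃ p : ℂ[X], f c = p.comp (f mY) := by
    intro c
    induction c using minus_induction with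
    | hC r => exact ⟨C r, by simp⟩
    | hX =>
      rcases h3 with h | h
      · exact ⟨X, by simp [h]⟩
      · exact ⟨-X, by simp [h]⟩
    | hY => exact ⟨X, by simp⟩
    | hadd a b ha hb =>
      obtain ⟨p, hp⟩ := ha
      obtain ⟨q, hq⟩ := hb
      exact ⟨p + q, by simp [hp, hq]⟩
    | hmul a b ha hb =>
      obtain ⟨p, hp⟩ := ha
      obtain ⟨q, hq⟩ := hb
      exact ⟨p * q, by simp [hp, hq]⟩
  obtain ⟨p, hp⟩ := key a
  have h4 := congrArg natDegree (ha.symm.trans hp)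
  rw [natDegree_X, natDegree_comp] at h4
  have h5 : (f mY).natDegree = 1 := Nat.eq_one_of_mul_eq_one_left h4.symm
  rcases h3 with h | h <;> simp [h, h5]

open Polynomial in
theorem eq_of_low {p q : ℂ[X]} (hp : p.natDegree ≤ 1) (hq : q.natDegree ≤ 1)
    (h : X ^ 2 ∣ p - q) : p = q := by
  rw [← sub_eq_zero]
  by_contra hne
  have h1 := natDegree_le_of_dvd h hne
  have h2 := natDegree_sub_le p q
  simp at h1
  omega

theorem stmt16 (h : MinusAlg ≃ₐ[ℂ] MinusAlg)
    (hx : h mX = - mX) (hy : h mY = mY) :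
    IsEmpty ((fixedSubalgebra1 h) ≃ₐ[ℂ] MinusAlg) := by
  refine ⟨fun e => ?_⟩
  have h1 : (1 : ℂ) * 1 = 1 := by norm_num
  have h2 : (-1 : ℂ) * -1 = 1 := by norm_num
  let f : ∀ s : ℂ, s * s = 1 → (MinusAlg →ₐ[ℂ] Polynomial ℂ) :=
    fun s hs => (chi h hx hy s hs).comp e.symm.toAlgHom
  have hf : ∀ s hs b, f s hs (e b) = rep s hs b.1 0 0 := by
    intro s hs b
    show chi h hx hy s hs (e.symm (e b)) = _
    rw [e.symm_apply_apply]
    rfl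
  have hdeg : ∀ s hs, (f s hs mX).natDegree ≤ 1 ∧ (f s hs mY).natDegree ≤ 1 := by
    intro s hs
    refine degree_bound _ (e ⟨mY, hy⟩) ?_
    rw [hf]
    simp [rep_Y]
  have hcong : ∀ a, Polynomial.X ^ 2 ∣ f 1 h1 a - f (-1) h2 a :=
    fun a => (rep_congr 1 (-1) h1 h2 (e.symm a).1).2.2.2.2
  have hfe : ∀ a, f 1 h1 a = f (-1) h2 a := by
    intro a
    induction a using minus_induction with
    | hC r => simp only [AlgHom.commutes]
    | hX => exact eq_of_low (hdeg _ _).1 (hdeg _ _).1 (hcong _)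
    | hY => exact eq_of_low (hdeg _ _).2 (hdeg _ _).2 (hcong _)
    | hadd a b ha hb => rw [map_add, map_add, ha, hb]
    | hmul a b ha hb => rw [map_mul, map_mul, ha, hb]
  have hz : h (mX * mY * mX) = mX * mY * mX := by
    have hn : ∀ (R : Type) [Ring R] (a b : R), -a * b * -a = a * b * a := by
      intro R _ a b
      simp
    rw [map_mul, map_mul, hx, hy]
    exact hn MinusAlg mX mY
  have h3 := hfe (e ⟨mX * mY * mX, hz⟩)
  rw [hf, hf] at h3
  simp only [map_mul, rep_X, rep_Y] at h3
  have h4 := congrArg (Polynomial.eval 1) h3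
  simp [Matrix.mul_apply, Fin.sum_univ_two] at h4
  norm_num at h4
end
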